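/- arXiv:1706.00649 — 2 statements merged into one kernel-verified Lean document; each statement's English description precedes it below -/
import Mathlib

section
/- Every almost-Riemannian structure on the Lie group Aff₊(2) is isometric to one and only one of the ARSs defined by the derivation D = [[0,0],[1,b]] (in the basis (X,Y)) and the left-invariant vector field B = αX, where α > 0 and b ≥ 0. -/
open Set ENNReal

noncomputable section

/-- The carrier of the connected 2-dimensional affine group `Aff₊(2)`, identified in
coordinates with `{(x, y) : x > 0, y ∈ ℝ}`. -/
def affCarrier : Set (ℝ × ℝ) := {p | 0 < p.1}

/-- The group product of `Aff₊(2)`: `(x,y)·(x',y') = (xx', xy' + y)`. -/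
def affMul (p q : ℝ × ℝ) : ℝ × ℝ := (p.1 * q.1, p.1 * q.2 + p.2)

/-- The identity element of `Aff₊(2)`. -/
def affOne : ℝ × ℝ := (1, 0)

/-- The left-invariant vector field `X = x ∂/∂x`. -/
def affX (p : ℝ × ℝ) : ℝ × ℝ := (p.1, 0)

/-- The left-invariant vector field `Y = x ∂/∂y`. -/
def affY (p : ℝ × ℝ) : ℝ × ℝ := (0, p.1)

/-- The data of an ARS on `Aff₊(2)`: the left-invariant vector field `B = αX + βY`
and the derivation `D = [[0,0],[a,b]]` (in the basis `(X,Y)`), whose associated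
linear vector field is `𝒳(x,y) = (a(x-1) + by) ∂/∂y`. -/
structure AffARS where
  α : ℝ
  β : ℝ
  a : ℝ
  b : ℝ

/-- The left-invariant vector field `B = αX + βY`. -/
def AffARS.B (S : AffARS) (p : ℝ × ℝ) : ℝ × ℝ := S.α • affX p + S.β • affY p

/-- The linear vector field `𝒳(x,y) = (a(x-1) + by) ∂/∂y`. -/
def AffARS.lin (S : AffARS) (p : ℝ × ℝ) : ℝ × ℝ := (0, S.a * (p.1 - 1) + S.b * p.2)

/-- The condition for the data to define an ARS: `B` and `DB` are linearly
independent, equivalently `α(aα + bβ) ≠ 0`. -/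
def AffARS.IsARS (S : AffARS) : Prop := S.α * (S.a * S.α + S.b * S.β) ≠ 0

/-- The almost-Riemannian norm of a tangent vector `v` at `p`: the infimum of
`√(c² + u²)` over the decompositions `v = c·𝒳(p) + u·B(p)`, infinite if there is
no such decomposition. -/
def AffARS.enorm (S : AffARS) (p : ℝ × ℝ) (v : ℝ × ℝ) : ℝ≥0∞ :=
  sInf {r : ℝ≥0∞ | ∃ c u : ℝ, c • S.lin p + u • S.B p = v ∧
    r = ENNReal.ofReal (Real.sqrt (c ^ 2 + u ^ 2))}

/-- A diffeomorphism of `Aff₊(2)`, in coordinates: a bijection of the carrier onto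
itself, smooth with smooth inverse. -/
structure IsAffDiffeo (Φ : ℝ × ℝ → ℝ × ℝ) : Prop where
  bij : BijOn Φ affCarrier affCarrier
  smooth : ContDiffOn ℝ (⊤ : ℕ∞) Φ affCarrier
  exists_smooth_inv : ∃ Ψ : ℝ × ℝ → ℝ × ℝ,
    InvOn Ψ Φ affCarrier affCarrier ∧ ContDiffOn ℝ (⊤ : ℕ∞) Ψ affCarrier

/-- An isometry from the ARS `S` onto the ARS `S'` on `Aff₊(2)`: a diffeomorphism
whose differential respects the almost-Riemannian norms at every point. -/
def IsAffIsometry (S S' : AffARS) (Φ : ℝ × ℝ → ℝ × ℝ) : Prop :=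
  IsAffDiffeo Φ ∧ ∀ p ∈ affCarrier, ∀ v : ℝ × ℝ,
    S'.enorm (Φ p) (fderiv ℝ Φ p v) = S.enorm p v

/-- Two ARSs on `Aff₊(2)` are isometric if there is an isometry from one onto the other. -/
def AffIsometric (S S' : AffARS) : Prop := ∃ Φ, IsAffIsometry S S' Φ

theorem eq_at_zero_of_eq_on_pos {f g : ℝ → ℝ} (hf : Continuous f) (hg : Continuous g)
    (h : ∀ t, 0 < t → f t = g t) : f 0 = g 0 := by
  have : EqOn f g (closure (Ioi 0)) := EqOn.closure (fun t ht => h t ht) hf hg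
  exact this (by simp)

/-- The smooth function `f` has derivatives `a₀, a₁, a₂, a₃` of orders `0` to `3` at the origin. -/
structure HasThreeJet (f : ℝ → ℝ) (a₀ a₁ a₂ a₃ : ℝ) : Prop where
  smooth : ContDiff ℝ (⊤ : ℕ∞) f
  zero : f 0 = a₀
  one : iteratedDeriv 1 f 0 = a₁
  two : iteratedDeriv 2 f 0 = a₂
  three : iteratedDeriv 3 f 0 = a₃

namespace HasThreeJet

variable {f g : ℝ → ℝ} {a₀ a₁ a₂ a₃ b₀ b₁ b₂ b₃ : ℝ}

theorem of_contDiff (hf : ContDiff ℝ (⊤ : ℕ∞) f) :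
    HasThreeJet f (f 0) (iteratedDeriv 1 f 0) (iteratedDeriv 2 f 0) (iteratedDeriv 3 f 0) :=
  ⟨hf, rfl, rfl, rfl, rfl⟩

theorem const (c : ℝ) : HasThreeJet (fun _ => c) c 0 0 0 :=
  ⟨contDiff_const, rfl, by simp, by simp [iteratedDeriv_succ'], by simp [iteratedDeriv_succ']⟩

theorem add (hf : HasThreeJet f a₀ a₁ a₂ a₃) (hg : HasThreeJet g b₀ b₁ b₂ b₃) :
    HasThreeJet (f + g) (a₀ + b₀) (a₁ + b₁) (a₂ + b₂) (a₃ + b₃) := by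
  have key (n : ℕ) : iteratedDeriv n (f + g) 0 = iteratedDeriv n f 0 + iteratedDeriv n g 0 :=
    iteratedDeriv_add (hf.smooth.of_le (by exact_mod_cast le_top)).contDiffAt
      (hg.smooth.of_le (by exact_mod_cast le_top)).contDiffAt
  refine ⟨hf.smooth.add hg.smooth, by simp [hf.zero, hg.zero], ?_, ?_, ?_⟩
  · rw [key, hf.one, hg.one]
  · rw [key, hf.two, hg.two]
  · rw [key, hf.three, hg.three]

theorem mul (hf : HasThreeJet f a₀ a₁ a₂ a₃) (hg : HasThreeJet g b₀ b₁ b₂ b₃) :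
    HasThreeJet (f * g) (a₀ * b₀) (a₀ * b₁ + a₁ * b₀) (a₀ * b₂ + 2 * a₁ * b₁ + a₂ * b₀)
      (a₀ * b₃ + 3 * a₁ * b₂ + 3 * a₂ * b₁ + a₃ * b₀) := by
  have key (n : ℕ) := iteratedDeriv_mul (n := n) (x := (0 : ℝ))
    (hf.smooth.of_le (by exact_mod_cast le_top)).contDiffAt
    (hg.smooth.of_le (by exact_mod_cast le_top)).contDiffAt
  refine ⟨hf.smooth.mul hg.smooth, by simp [hf.zero, hg.zero], ?_, ?_, ?_⟩ <;>
  · rw [key]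
    simp [Finset.sum_range_succ, Nat.choose, hf.zero, hf.one, hf.two, hf.three, hg.zero, hg.one,
      hg.two, hg.three, -iteratedDeriv_one]

theorem antideriv (hf : ContDiff ℝ (⊤ : ℕ∞) f) (h : HasThreeJet (deriv f) a₀ a₁ a₂ a₃) :
    HasThreeJet f (f 0) a₀ a₁ a₂ :=
  ⟨hf, rfl, by rw [iteratedDeriv_one, h.zero], by rw [iteratedDeriv_succ', h.one],
    by rw [iteratedDeriv_succ', h.two]⟩

theorem exp (hf : HasThreeJet f a₀ a₁ a₂ a₃) :
    HasThreeJet (fun t => Real.exp (f t)) (Real.exp a₀) (Real.exp a₀ * a₁)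
      (Real.exp a₀ * (a₂ + a₁ ^ 2)) (Real.exp a₀ * (a₃ + 3 * a₁ * a₂ + a₁ ^ 3)) := by
  have hs : ContDiff ℝ (⊤ : ℕ∞) (fun t => Real.exp (f t)) := hf.smooth.exp
  have hd : deriv (fun t => Real.exp (f t)) = (fun t => Real.exp (f t)) * deriv f := by
    ext t
    exact deriv_exp (hf.smooth.differentiable (by simp) t)
  have hf' : ContDiff ℝ (⊤ : ℕ∞) (deriv f) := (contDiff_infty_iff_deriv.1 hf.smooth).2
  have h0 : Real.exp (f 0) = Real.exp a₀ := by rw [hf.zero]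
  have h1 := hf.one
  have h2 := hf.two
  have h3 := hf.three
  rw [iteratedDeriv_one] at h1
  rw [iteratedDeriv_succ'] at h2 h3
  have J1 : HasThreeJet (fun t => Real.exp (f t)) _ _ _ _ := of_contDiff hs
  have P1 := J1.mul (of_contDiff hf')
  rw [← hd, h1, h2, h3, h0] at P1
  have J2 := antideriv hs P1
  have e1 := J2.one
  have e2 := J2.two
  have e3 := J2.three
  rw [e1] at e2
  rw [e1, e2] at e3
  exact ⟨hs, h0, by rw [e1], by rw [e2]; ring, by rw [e3]; ring⟩

/-- Functions that agree on the positive half-line have the same jet at the origin. -/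
theorem unique (hf : HasThreeJet f a₀ a₁ a₂ a₃) (hg : HasThreeJet g b₀ b₁ b₂ b₃)
    (h : ∀ t, 0 < t → f t = g t) : a₀ = b₀ ∧ a₁ = b₁ ∧ a₂ = b₂ ∧ a₃ = b₃ := by
  have h' : EqOn f g (Ici 0) := by
    rw [← closure_Ioi]
    exact EqOn.closure (fun t ht => h t ht) hf.smooth.continuous hg.smooth.continuous
  have key (n : ℕ) : iteratedDeriv n f 0 = iteratedDeriv n g 0 := by
    rw [← iteratedDerivWithin_eq_iteratedDeriv (uniqueDiffOn_Ici (0 : ℝ))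
        (hf.smooth.of_le (by exact_mod_cast le_top)).contDiffAt self_mem_Ici,
      ← iteratedDerivWithin_eq_iteratedDeriv (uniqueDiffOn_Ici (0 : ℝ))
        (hg.smooth.of_le (by exact_mod_cast le_top)).contDiffAt self_mem_Ici]
    exact iteratedDerivWithin_congr h' self_mem_Ici
  exact ⟨by rw [← hf.zero, ← hg.zero, h' self_mem_Ici], by rw [← hf.one, ← hg.one, key],
    by rw [← hf.two, ← hg.two, key], by rw [← hf.three, ← hg.three, key]⟩

end HasThreeJet

/-- Jet comparison, at a point of the singular locus, for the equations of an isometry between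
two structures in normal form. -/
theorem parameters_eq_of_isometry_equations {α α' b b' ε : ℝ} (hα : 0 < α) (hα' : 0 < α')
    (hb : 0 ≤ b) (hb' : 0 ≤ b') (hε : ε ^ 2 = 1) {U V W Z Q R : ℝ → ℝ}
    (hU : ContDiff ℝ (⊤ : ℕ∞) U) (hV : ContDiff ℝ (⊤ : ℕ∞) V) (hW : ContDiff ℝ (⊤ : ℕ∞) W)
    (hZ : ContDiff ℝ (⊤ : ℕ∞) Z) (hQ : ContDiff ℝ (⊤ : ℕ∞) Q) (hR : ContDiff ℝ (⊤ : ℕ∞) R)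
    (h₁ : ∀ t, 0 < t → deriv U t ^ 2 + (Real.exp (α * t) - 1) ^ 2 * W t ^ 2 = 1)
    (h₂ : ∀ t, 0 < t →
      deriv U t * deriv V t + (Real.exp (α * t) - 1) ^ 2 * (W t * Z t) = 0)
    (h₃ : ∀ t, 0 < t → (Real.exp (α * t) - 1) * Z t =
      ε * ((Real.exp (α' * U t) - 1 + b' * V t) * deriv U t))
    (h₄ : ∀ t, 0 < t → Q t * deriv V t + deriv U t * deriv Z t +
      2 * b * (Real.exp (α * t) - 1) * (W t * Z t) + (Real.exp (α * t) - 1) ^ 2 * R t = 0)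
    (h₅ : ∃ Y, b * Z 0 + (Real.exp (α * 0) - 1) * Y =
      ε * ((Real.exp (α' * U 0) * (α' * W 0) + b' * Z 0) * deriv U 0 +
        (Real.exp (α' * U 0) - 1 + b' * V 0) * Q 0)) :
    α = α' ∧ b = b' := by
  have smooth_deriv {g : ℝ → ℝ} (hg : ContDiff ℝ (⊤ : ℕ∞) g) : ContDiff ℝ (⊤ : ℕ∞) (deriv g) :=
    (contDiff_infty_iff_deriv.1 hg).2
  have hC := HasThreeJet.of_contDiff (smooth_deriv hU)
  have hUj := HasThreeJet.antideriv hU hC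
  have hV' := HasThreeJet.of_contDiff (smooth_deriv hV)
  have hVj := HasThreeJet.antideriv hV hV'
  have hZ' := HasThreeJet.of_contDiff (smooth_deriv hZ)
  have hZj := HasThreeJet.antideriv hZ hZ'
  have hWj := HasThreeJet.of_contDiff hW
  have hQj := HasThreeJet.of_contDiff hQ
  have hRj := HasThreeJet.of_contDiff hR
  have hid : HasThreeJet (fun t => t) 0 1 0 0 :=
    ⟨contDiff_id, rfl, by simp, by simp [iteratedDeriv_succ'], by simp [iteratedDeriv_succ']⟩
  have hf := (((HasThreeJet.const α).mul hid).exp).add (HasThreeJet.const (-1))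
  have hf2 := hf.mul hf
  have hWZ := hWj.mul hZj
  have hF := ((((HasThreeJet.const α').mul hUj).exp).add (HasThreeJet.const (-1))).add
    ((HasThreeJet.const b').mul hVj)
  obtain ⟨p0, p1, p2, -⟩ := ((hC.mul hC).add (hf2.mul (hWj.mul hWj))).unique
    (HasThreeJet.const 1) (fun t ht => by
      have := h₁ t ht; simp only [Pi.add_apply, Pi.mul_apply]; linear_combination this)
  obtain ⟨q0, q1, q2, -⟩ := ((hC.mul hV').add (hf2.mul hWZ)).unique
    (HasThreeJet.const 0) (fun t ht => by
      have := h₂ t ht; simp only [Pi.add_apply, Pi.mul_apply]; linear_combination this)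
  obtain ⟨r0, r1, r2, r3⟩ := (hf.mul hZj).unique ((HasThreeJet.const ε).mul (hF.mul hC))
    (fun t ht => by
      have := h₃ t ht; simp only [Pi.add_apply, Pi.mul_apply]; linear_combination this)
  obtain ⟨s0, s1, -, -⟩ := ((((hQj.mul hV').add (hC.mul hZ')).add
    ((HasThreeJet.const (2 * b)).mul (hf.mul hWZ))).add (hf2.mul hRj)).unique
    (HasThreeJet.const 0) (fun t ht => by
      have := h₄ t ht; simp only [Pi.add_apply, Pi.mul_apply]; linear_combination this)
  obtain ⟨Y, h₅⟩ := h₅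
  clear h₁ h₂ h₃ h₄ hC hUj hV' hVj hZ' hZj hWj hQj hRj hid hf hf2 hWZ hF smooth_deriv
  simp only [mul_zero, Real.exp_zero, zero_mul, add_zero, zero_add, mul_one, one_mul,
    add_neg_cancel, sub_self] at *
  generalize iteratedDeriv 1 (deriv U) 0 = C1 at *
  generalize iteratedDeriv 2 (deriv U) 0 = C2 at *
  generalize iteratedDeriv 3 (deriv U) 0 = C3 at *
  generalize iteratedDeriv 1 (deriv V) 0 = V2 at *
  generalize iteratedDeriv 2 (deriv V) 0 = V3 at *
  generalize iteratedDeriv 1 (deriv Z) 0 = Z2 at *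
  generalize iteratedDeriv 1 Q 0 = Q1 at *
  generalize deriv U 0 = c at *
  generalize deriv V 0 = V1 at *
  generalize deriv Z 0 = Z1 at *
  generalize iteratedDeriv 2 (deriv Z) 0 = Z3 at *
  generalize iteratedDeriv 1 W 0 = W1 at *
  generalize U 0 = U0 at *
  generalize V 0 = V0 at *
  generalize W 0 = w at *
  generalize Z 0 = z at *
  generalize Q 0 = Q0 at *
  generalize R 0 = R0 at *
  have hu := Real.exp_pos (α' * U0)
  generalize Real.exp (α' * U0) = u at *
  have hc : c ≠ 0 := by rintro rfl; simp at p0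
  have hε0 : ε ≠ 0 := by rintro rfl; simp at hε
  have hV1 : V1 = 0 := by simpa [hc] using q0
  have hC1 : C1 = 0 := by
    have : c * C1 = 0 := by linear_combination p1 / 2
    simpa [hc] using this
  subst hV1 hC1
  have hV2 : V2 = 0 := by
    have : c * V2 = 0 := by linear_combination q1
    simpa [hc] using this
  have hZ1 : Z1 = 0 := by
    have : c * Z1 = 0 := by linear_combination s0
    simpa [hc] using this
  subst hV2 hZ1
  have hF0 : u - 1 + b' * V0 = 0 := by
    have : ε * c * (u - 1 + b' * V0) = 0 := by linear_combination -r0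
    simpa [hc, hε0] using this
  have hz : α * z = ε * α' * u := by linear_combination r1 + ε * α' * u * p0
  have hz0 : z ≠ 0 := by
    rintro rfl
    have : ε * (α' * u) = 0 := by linear_combination -hz
    simp [hε0, hα'.ne', hu.ne'] at this

  have hcα : α = α' * c := by
    have : ε * α' * u * (α - α' * c) = 0 := by
      linear_combination r2 - α * hz + ε * C2 * hF0 + ε * α' ^ 2 * c * u * p0
    simpa [hε0, hα'.ne', hu.ne', sub_eq_zero] using this
  have hc1 : c = 1 := by
    have hc_pos : 0 < c := by
      rw [hcα] at hα
      exact (pos_iff_pos_of_mul_pos hα).1 hα'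
    nlinarith
  subst hc1
  rw [mul_one] at hcα
  subst hcα
  refine ⟨rfl, ?_⟩
  have hzu : z = ε * u := mul_left_cancel₀ hα.ne' (by linear_combination hz)
  have hC2 : C2 = -(α ^ 2 * w ^ 2) := by linear_combination p2 / 2
  have hV3 : V3 = -(2 * α ^ 2 * w * z) := by linear_combination q2
  have hZ2 : Z2 = -(2 * b * α * w * z) := by linear_combination s1
  have hw : α * w = b - ε * b' := by
    have : z * (α * w - (b - ε * b')) = 0 := by
      linear_combination -h₅ + α * w * hzu - ε * Q0 * hF0
    have := (mul_eq_zero.1 this).resolve_left hz0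
    linear_combination this
  have key : (b - ε * b') * (b + ε * b') = 0 := by
    have h : z * α ^ 2 * (3 * b * w - 2 * α * w ^ 2 - ε * b' * w) = 0 := by
      subst hC2 hV3 hZ2
      linear_combination -r3 / 2 + (α ^ 3 / 2 - 2 * α ^ 3 * w ^ 2) * hzu - ε * C3 / 2 * hF0
    have h := (mul_eq_zero.1 h).resolve_left (mul_ne_zero hz0 (pow_ne_zero 2 hα.ne'))
    linear_combination α * h + (2 * α * w - 3 * b + ε * b' + 2 * (b - ε * b')) * hw
  rw [← sq_eq_sq₀ hb hb']
  linear_combination key + b' ^ 2 * hε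

theorem isOpen_affCarrier : IsOpen affCarrier :=
  isOpen_lt continuous_const continuous_fst

/-- The norm of the ARS in normal form, off its singular locus. -/
theorem enorm_normalForm {α b : ℝ} (hα : α ≠ 0) {p : ℝ × ℝ} (hp : p.1 ≠ 0)
    (hf : p.1 - 1 + b * p.2 ≠ 0) (v : ℝ × ℝ) :
    (AffARS.mk α 0 1 b).enorm p v =
      ENNReal.ofReal (Real.sqrt ((v.2 / (p.1 - 1 + b * p.2)) ^ 2 + (v.1 / (α * p.1)) ^ 2)) := by
  have hset : {r : ℝ≥0∞ | ∃ c u : ℝ, c • (AffARS.mk α 0 1 b).lin p +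
      u • (AffARS.mk α 0 1 b).B p = v ∧ r = ENNReal.ofReal (Real.sqrt (c ^ 2 + u ^ 2))} =
      {ENNReal.ofReal
        (Real.sqrt ((v.2 / (p.1 - 1 + b * p.2)) ^ 2 + (v.1 / (α * p.1)) ^ 2))} := by
    ext r
    simp only [mem_ofPred_eq, mem_singleton_iff]
    constructor
    · rintro ⟨c, u, rfl, rfl⟩
      have h₁ : c * (p.1 - 1 + b * p.2) / (p.1 - 1 + b * p.2) = c := by field_simp
      have h₂ : u * (α * p.1) / (α * p.1) = u := by field_simp
      simp [AffARS.lin, AffARS.B, affX, affY, h₁, h₂]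
    · rintro rfl
      refine ⟨v.2 / (p.1 - 1 + b * p.2), v.1 / (α * p.1), ?_, rfl⟩
      ext
      · simp [AffARS.lin, AffARS.B, affX, affY]
        field_simp
      · simp [AffARS.lin, AffARS.B, affX, affY]
        field_simp
  rw [AffARS.enorm, hset, sInf_singleton]

/-- On the singular locus, only multiples of `X` have finite norm. -/
theorem enorm_normalForm_eq_top {α b : ℝ} {p v : ℝ × ℝ} (hf : p.1 - 1 + b * p.2 = 0)
    (hv : v.2 ≠ 0) : (AffARS.mk α 0 1 b).enorm p v = ⊤ := by
  rw [AffARS.enorm, sInf_eq_top]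
  rintro r ⟨c, u, rfl, -⟩
  simp [AffARS.lin, AffARS.B, affX, affY, hf] at hv

theorem enorm_zero_right (S : AffARS) (p : ℝ × ℝ) : S.enorm p 0 = 0 := by
  refine le_antisymm (sInf_le ⟨0, 0, by simp, by simp⟩) zero_le

/-- An isometry between normal forms, in the coordinates `(α⁻¹ log x, y)`. -/
theorem IsAffIsometry.exists_logCoordinates {α b α' b' : ℝ} (hα : α ≠ 0) (hα' : α' ≠ 0)
    {Φ : ℝ × ℝ → ℝ × ℝ} (h : IsAffIsometry (AffARS.mk α 0 1 b) (AffARS.mk α' 0 1 b') Φ) :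
    ∃ U V : ℝ × ℝ → ℝ, ContDiff ℝ (⊤ : ℕ∞) U ∧ ContDiff ℝ (⊤ : ℕ∞) V ∧
      ∀ p : ℝ × ℝ, Real.exp (α * p.1) - 1 + b * p.2 ≠ 0 →
        Real.exp (α' * U p) - 1 + b' * V p ≠ 0 ∧
        ∀ w : ℝ × ℝ, (fderiv ℝ U p w) ^ 2 +
          (fderiv ℝ V p w / (Real.exp (α' * U p) - 1 + b' * V p)) ^ 2 =
          w.1 ^ 2 + (w.2 / (Real.exp (α * p.1) - 1 + b * p.2)) ^ 2 := by
  obtain ⟨⟨hbij, hsm, -⟩, hnorm⟩ := h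
  set G : ℝ × ℝ → ℝ × ℝ := fun p => (Real.exp (α * p.1), p.2) with hG
  have hGs : ContDiff ℝ (⊤ : ℕ∞) G := by fun_prop
  have hGc (p) : G p ∈ affCarrier := Real.exp_pos _
  have hH : ContDiff ℝ (⊤ : ℕ∞) (fun p => Φ (G p)) := hsm.comp_contDiff hGs hGc
  have hpos (p) : 0 < (Φ (G p)).1 := hbij.mapsTo (hGc p)
  have hexp (p) : Real.exp (α' * (Real.log (Φ (G p)).1 / α')) = (Φ (G p)).1 := by
    rw [mul_div_cancel₀ _ hα', Real.exp_log (hpos p)]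
  have hG' (p : ℝ × ℝ) : HasFDerivAt G
      ((((Real.exp (α * p.1)) • (α • ContinuousLinearMap.fst ℝ ℝ ℝ))).prod
        (ContinuousLinearMap.snd ℝ ℝ ℝ)) p :=
    ((hasFDerivAt_fst.const_mul α).exp).prodMk hasFDerivAt_snd
  have hH' (p : ℝ × ℝ) : HasFDerivAt (fun p => Φ (G p))
      ((fderiv ℝ Φ (G p)).comp _) p :=
    (((hsm.contDiffAt (isOpen_affCarrier.mem_nhds (hGc p))).differentiableAt
      (by simp)).hasFDerivAt).comp p (hG' p)
  refine ⟨fun p => Real.log (Φ (G p)).1 / α', fun p => (Φ (G p)).2,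
    (hH.fst.log fun p => (hpos p).ne').div_const α', hH.snd, fun p hp => ?_⟩
  set L := fderiv ℝ Φ (G p) with hL
  have hU' : HasFDerivAt (fun p => Real.log (Φ (G p)).1 / α') _ p :=
    (((hH' p).fst.log (hpos p).ne')).mul_const α'⁻¹
  have hV' : HasFDerivAt (fun p => (Φ (G p)).2) _ p := (hH' p).snd
  have hsource := enorm_normalForm (p := G p) hα (hGc p).ne' hp
  have hF : (Φ (G p)).1 - 1 + b' * (Φ (G p)).2 ≠ 0 := by
    intro hF
    have hL2 (v : ℝ × ℝ) : (L v).2 = 0 := by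
      by_contra hv
      have := hnorm (G p) (hGc p) v
      rw [enorm_normalForm_eq_top hF hv, hsource] at this
      exact ENNReal.ofReal_ne_top this.symm
    obtain ⟨v, hv, hLv⟩ : ∃ v : ℝ × ℝ, v ≠ 0 ∧ (L v).1 = 0 := by
      by_cases h10 : (L (1, 0)).1 = 0
      · exact ⟨(1, 0), by simp, h10⟩
      · refine ⟨(L (0, 1)).1 • (1, 0) - (L (1, 0)).1 • (0, 1), fun h => h10 ?_, ?_⟩
        · simpa using congrArg Prod.snd h
        · rw [map_sub, map_smul, map_smul]
          simp [mul_comm]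
    have := hnorm (G p) (hGc p) v
    rw [← hL, show L v = 0 from Prod.ext hLv (hL2 v), enorm_zero_right, hsource, eq_comm,
      ENNReal.ofReal_eq_zero, Real.sqrt_le_iff] at this
    obtain ⟨-, hle⟩ := this
    have e1 : v.1 / (α * (G p).1) = 0 := by
      rw [← sq_eq_zero_iff]
      nlinarith [sq_nonneg (v.2 / ((G p).1 - 1 + b * (G p).2)), sq_nonneg (v.1 / (α * (G p).1))]
    have e2 : v.2 / ((G p).1 - 1 + b * (G p).2) = 0 := by
      rw [← sq_eq_zero_iff]
      nlinarith [sq_nonneg (v.2 / ((G p).1 - 1 + b * (G p).2)), sq_nonneg (v.1 / (α * (G p).1))]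
    rw [_root_.div_eq_zero_iff] at e1 e2
    exact hv (Prod.ext (e1.resolve_right (mul_ne_zero hα (hGc p).ne')) (e2.resolve_right hp))
  rw [hexp]
  refine ⟨hF, fun w => ?_⟩
  have := hnorm (G p) (hGc p) (Real.exp (α * p.1) * (α * w.1), w.2)
  rw [hsource, enorm_normalForm hα' (hpos p).ne' hF,
    ENNReal.ofReal_eq_ofReal_iff (Real.sqrt_nonneg _) (Real.sqrt_nonneg _),
    Real.sqrt_inj (by positivity) (by positivity)] at this
  rw [hU'.fderiv, hV'.fderiv]
  have hw : Real.exp (α * p.1) * (α * w.1) / (α * (G p).1) = w.1 := by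
    simp only [hG]
    field_simp
  have hl (z : ℝ) : α'⁻¹ * ((Φ (G p)).1⁻¹ * z) = z / (α' * (Φ (G p)).1) := by
    have := (hpos p).ne'
    field_simp
  rw [hw] at this
  simp only [hG] at this hl ⊢
  simp [hl] at this ⊢
  linarith

theorem hasDerivAt_slice_fst {g : ℝ × ℝ → ℝ} (hg : ContDiff ℝ (⊤ : ℕ∞) g) (t y : ℝ) :
    HasDerivAt (fun s => g (s, y)) (fderiv ℝ g (t, y) (1, 0)) t :=
  ((hg.differentiable (by simp) (t, y)).hasFDerivAt).comp_hasDerivAt t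
    ((hasDerivAt_id t).prodMk (hasDerivAt_const t y))

theorem hasDerivAt_slice_snd {g : ℝ × ℝ → ℝ} (hg : ContDiff ℝ (⊤ : ℕ∞) g) (t y : ℝ) :
    HasDerivAt (fun s => g (t, s)) (fderiv ℝ g (t, y) (0, 1)) y :=
  ((hg.differentiable (by simp) (t, y)).hasFDerivAt).comp_hasDerivAt y
    ((hasDerivAt_const y t).prodMk (hasDerivAt_id y))

theorem contDiff_fderiv_apply_const {g : ℝ × ℝ → ℝ} (hg : ContDiff ℝ (⊤ : ℕ∞) g) (w : ℝ × ℝ) :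
    ContDiff ℝ (⊤ : ℕ∞) (fun p => fderiv ℝ g p w) :=
  (hg.fderiv_right (by simp)).clm_apply contDiff_const

theorem fderiv_fderiv_apply_comm {g : ℝ × ℝ → ℝ} (hg : ContDiff ℝ (⊤ : ℕ∞) g)
    (p v w : ℝ × ℝ) :
    fderiv ℝ (fun q => fderiv ℝ g q v) p w = fderiv ℝ (fun q => fderiv ℝ g q w) p v := by
  have h (u z : ℝ × ℝ) : fderiv ℝ (fun q => fderiv ℝ g q u) p z = fderiv ℝ (fderiv ℝ g) p z u := by
    have hd : DifferentiableAt ℝ (fderiv ℝ g) p :=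
      (hg.fderiv_right (m := (⊤ : ℕ∞)) (by simp)).differentiable (by simp) p
    rw [fderiv_clm_apply hd (differentiableAt_const u)]
    simp
  rw [h, h]
  exact ((contDiff_infty.1 hg 2).contDiffAt.isSymmSndFDerivAt (by simp)) w v

/-- A `2 × 2` matrix with orthonormal columns has orthonormal rows and determinant `±1`. -/
theorem orthonormal_rows {a b c d : ℝ} (h₁ : a ^ 2 + c ^ 2 = 1) (h₂ : b ^ 2 + d ^ 2 = 1)
    (h₃ : a * b + c * d = 0) :
    a ^ 2 + b ^ 2 = 1 ∧ a * c + b * d = 0 ∧ (a * d - b * c) ^ 2 = 1 := by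
  have h : a ^ 2 + b ^ 2 = 1 := by
    linear_combination (a * b - c * d) * h₃ + d ^ 2 * h₁ + (1 - a ^ 2) * h₂
  refine ⟨h, ?_, ?_⟩
  · linear_combination (a * d + b * c) * h₃ - a * c * h₂ - b * d * h₁
  · linear_combination h₁ * (b ^ 2 + d ^ 2) + h₂ - h₃ * (a * b + c * d)

theorem parameters_eq_of_isometry {α b α' b' : ℝ} (hα : 0 < α) (hα' : 0 < α')
    (hb : 0 ≤ b) (hb' : 0 ≤ b')
    (h : AffIsometric (AffARS.mk α 0 1 b) (AffARS.mk α' 0 1 b')) : α = α' ∧ b = b' := by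
  obtain ⟨Φ, hΦ⟩ := h
  obtain ⟨U, V, hU, hV, hmetric⟩ := hΦ.exists_logCoordinates hα.ne' hα'.ne'
  set f : ℝ × ℝ → ℝ := fun p => Real.exp (α * p.1) - 1 + b * p.2 with hf
  set F : ℝ × ℝ → ℝ := fun p => Real.exp (α' * U p) - 1 + b' * V p with hF
  set C : ℝ × ℝ → ℝ := fun p => fderiv ℝ U p (1, 0) with hC
  set W : ℝ × ℝ → ℝ := fun p => fderiv ℝ U p (0, 1) with hW
  set T : ℝ × ℝ → ℝ := fun p => fderiv ℝ V p (1, 0) with hT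
  set Z : ℝ × ℝ → ℝ := fun p => fderiv ℝ V p (0, 1) with hZ
  have hfs : ContDiff ℝ (⊤ : ℕ∞) f := by fun_prop
  have hFs : ContDiff ℝ (⊤ : ℕ∞) F := by fun_prop
  have hCs : ContDiff ℝ (⊤ : ℕ∞) C := contDiff_fderiv_apply_const hU _
  have hWs : ContDiff ℝ (⊤ : ℕ∞) W := contDiff_fderiv_apply_const hU _
  have hTs : ContDiff ℝ (⊤ : ℕ∞) T := contDiff_fderiv_apply_const hV _
  have hZs : ContDiff ℝ (⊤ : ℕ∞) Z := contDiff_fderiv_apply_const hV _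
  have hrows (p) (hp : f p ≠ 0) : C p ^ 2 + f p ^ 2 * W p ^ 2 = 1 ∧
      C p * T p + f p ^ 2 * (W p * Z p) = 0 ∧
      (f p * (C p * Z p - W p * T p)) ^ 2 = F p ^ 2 := by
    obtain ⟨hFp, hq⟩ := hmetric p hp
    change F p ≠ 0 at hFp
    have hfp := hp
    have hexpand (ξ η : ℝ) : (C p * ξ + W p * η) ^ 2 + ((T p * ξ + Z p * η) / F p) ^ 2 =
        ξ ^ 2 + (η / f p) ^ 2 := by
      have := hq (ξ, η)
      have e (L : ℝ × ℝ →L[ℝ] ℝ) : L (ξ, η) = L (1, 0) * ξ + L (0, 1) * η := by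
        have : ((ξ, η) : ℝ × ℝ) = ξ • (1, 0) + η • (0, 1) := by simp
        rw [this, map_add, map_smul, map_smul]
        simp [mul_comm]
      rw [e, e] at this
      exact this
    have h10 := hexpand 1 0
    have h01 := hexpand 0 (f p)
    have h11 := hexpand 1 (f p)
    rw [div_self hfp] at h01 h11
    obtain ⟨r₁, r₂, r₃⟩ := orthonormal_rows (a := C p) (b := f p * W p) (c := T p / F p)
      (d := f p * Z p / F p) (by linear_combination h10) (by linear_combination h01)
      (by linear_combination (h11 - h10 - h01) / 2)
    refine ⟨by linear_combination r₁, ?_, ?_⟩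
    · field_simp at r₂
      linear_combination r₂
    · field_simp at r₃
      linear_combination r₃
  set Ω : Set (ℝ × ℝ) := {p | 0 < α * p.1 + b * p.2} with hΩ
  have hΩo : IsOpen Ω := isOpen_lt continuous_const (by fun_prop)
  have hΩf (p) (hp : p ∈ Ω) : f p ≠ 0 := by
    have h1 := Real.add_one_le_exp (α * p.1)
    have h2 : 0 < α * p.1 + b * p.2 := hp
    have : 0 < f p := by simp only [hf]; linarith
    exact this.ne'
  have hΩc : Convex ℝ Ω := by
    intro p hp q hq s r hs hr hsr
    simp only [hΩ, mem_ofPred_eq, Prod.fst_add, Prod.snd_add, Prod.smul_fst, Prod.smul_snd,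
      smul_eq_mul] at hp hq ⊢
    rcases hs.eq_or_lt with rfl | hs
    · have : r = 1 := by linarith
      subst this
      simpa using hq
    · nlinarith [mul_pos hs hp, mul_nonneg hr hq.le]
  obtain ⟨ε, hε, hdet⟩ : ∃ ε : ℝ, ε ^ 2 = 1 ∧
      ∀ p ∈ Ω, f p * (C p * Z p - W p * T p) = ε * F p := by
    have hJ : Continuous (fun p => f p * (C p * Z p - W p * T p)) :=
      hfs.continuous.mul ((hCs.continuous.mul hZs.continuous).sub
        (hWs.continuous.mul hTs.continuous))
    rcases hΩc.isPreconnected.eq_or_eq_neg_of_sq_eq hJ.continuousOn hFs.continuous.continuousOn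
      (fun p hp => (hrows p (hΩf p hp)).2.2) (fun {p} hp => (hmetric p (hΩf p hp)).1) with h | h
    · exact ⟨1, by norm_num, fun p hp => by simpa using h hp⟩
    · exact ⟨-1, by norm_num, fun p hp => by simpa using h hp⟩
  have hthird (p) (hp : p ∈ Ω) : f p * Z p = ε * (F p * C p) := by
    obtain ⟨r₁, r₂, -⟩ := hrows p (hΩf p hp)
    linear_combination C p * hdet p hp - f p * Z p * r₁ + f p * W p * r₂
  have hpos (t : ℝ) (ht : 0 < t) : (t, (0 : ℝ)) ∈ Ω := by
    simpa [hΩ] using mul_pos hα ht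
  have hnear (t : ℝ) (ht : 0 < t) : ∀ᶠ y in nhds (0 : ℝ), (t, y) ∈ Ω :=
    (Continuous.prodMk_right t).continuousAt.eventually_mem (hΩo.mem_nhds (hpos t ht))
  have hline {g : ℝ × ℝ → ℝ} (hg : ContDiff ℝ (⊤ : ℕ∞) g) :
      ContDiff ℝ (⊤ : ℕ∞) (fun t => g (t, 0)) := hg.comp (by fun_prop)
  have hUd (t : ℝ) : deriv (fun t => U (t, 0)) t = C (t, 0) := (hasDerivAt_slice_fst hU t 0).deriv
  have hVd (t : ℝ) : deriv (fun t => V (t, 0)) t = T (t, 0) := (hasDerivAt_slice_fst hV t 0).deriv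
  have hZd (t : ℝ) : deriv (fun t => Z (t, 0)) t = fderiv ℝ T (t, 0) (0, 1) := by
    rw [(hasDerivAt_slice_fst hZs t 0).deriv]
    exact fderiv_fderiv_apply_comm hV _ _ _
  have hf0 (t : ℝ) : f (t, 0) = Real.exp (α * t) - 1 := by simp [hf]
  have hfy (t : ℝ) : HasDerivAt (fun y => f (t, y)) b 0 := by
    have := ((hasDerivAt_id (0 : ℝ)).const_mul b).const_add (Real.exp (α * t) - 1)
    rwa [mul_one] at this
  have hFy (t : ℝ) : HasDerivAt (fun y => F (t, y))
      (Real.exp (α' * U (t, 0)) * (α' * W (t, 0)) + b' * Z (t, 0)) 0 :=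
    ((((hasDerivAt_slice_snd hU t 0).const_mul α').exp).sub_const 1).add
      ((hasDerivAt_slice_snd hV t 0).const_mul b')
  refine parameters_eq_of_isometry_equations hα hα' hb hb' hε (hline hU) (hline hV) (hline hWs)
    (hline hZs) (Q := fun t => fderiv ℝ C (t, 0) (0, 1))
    (R := fun t => fderiv ℝ (fun p => W p * Z p) (t, 0) (0, 1))
    (hline (contDiff_fderiv_apply_const hCs _))
    (hline (contDiff_fderiv_apply_const (hWs.mul hZs) _)) ?_ ?_ ?_ ?_ ?_
  · intro t ht
    rw [hUd, ← hf0]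
    exact (hrows _ (hΩf _ (hpos t ht))).1
  · intro t ht
    rw [hUd, hVd, ← hf0]
    exact (hrows _ (hΩf _ (hpos t ht))).2.1
  · intro t ht
    rw [hUd, ← hf0]
    exact hthird _ (hpos t ht)
  · intro t ht
    rw [hUd, hVd, hZd, ← hf0]
    have hd := ((hasDerivAt_slice_snd hCs t 0).mul (hasDerivAt_slice_snd hTs t 0)).add
      (((hfy t).pow 2).mul (hasDerivAt_slice_snd (hWs.mul hZs) t 0))
    have hzero := hd.unique ((hasDerivAt_const (0 : ℝ) (0 : ℝ)).congr_of_eventuallyEq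
      ((hnear t ht).mono fun y hy => (hrows _ (hΩf _ hy)).2.1))
    simp at hzero
    linear_combination hzero
  · refine ⟨fderiv ℝ Z (0, 0) (0, 1), ?_⟩
    have hpos_eq (t : ℝ) (ht : 0 < t) :
        b * Z (t, 0) + f (t, 0) * fderiv ℝ Z (t, 0) (0, 1) =
        ε * ((Real.exp (α' * U (t, 0)) * (α' * W (t, 0)) + b' * Z (t, 0)) * C (t, 0) +
          F (t, 0) * fderiv ℝ C (t, 0) (0, 1)) :=
      ((hfy t).mul (hasDerivAt_slice_snd hZs t 0)).unique
        ((((hFy t).mul (hasDerivAt_slice_snd hCs t 0)).const_mul ε).congr_of_eventuallyEq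
          ((hnear t ht).mono fun y hy => hthird _ hy))
    have := eq_at_zero_of_eq_on_pos ?_ ?_ hpos_eq
    · rw [hUd, ← hf0]
      exact this
    · exact ((hline hZs).continuous.const_mul b).add ((hline hfs).continuous.mul
        (hline (contDiff_fderiv_apply_const hZs _)).continuous)
    · have c1 := (hline hU).continuous
      have c2 := (hline hWs).continuous
      have c3 := (hline hZs).continuous
      have c4 := (hline hCs).continuous
      have c5 := (hline hFs).continuous
      have c6 := (hline (contDiff_fderiv_apply_const hCs (0, 1))).continuous
      fun_prop

theorem AffIsometric.trans {S T R : AffARS} (h₁ : AffIsometric S T) (h₂ : AffIsometric T R) :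
    AffIsometric S R := by
  obtain ⟨Φ, ⟨hΦ, hΦs, Φi, hΦi, hΦis⟩, hΦn⟩ := h₁
  obtain ⟨Θ, ⟨hΘ, hΘs, Θi, hΘi, hΘis⟩, hΘn⟩ := h₂
  have hmaps : MapsTo Θi affCarrier affCarrier := hΘi.1.mapsTo hΘ.surjOn
  refine ⟨Θ ∘ Φ, ⟨hΘ.comp hΦ, hΘs.comp hΦs hΦ.mapsTo, Φi ∘ Θi,
    hΦi.comp hΘi hΦ.mapsTo hmaps, hΦis.comp hΘis hmaps⟩, fun p hp v => ?_⟩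
  have hd {g : ℝ × ℝ → ℝ × ℝ} (hg : ContDiffOn ℝ (⊤ : ℕ∞) g affCarrier) {q : ℝ × ℝ}
      (hq : q ∈ affCarrier) : DifferentiableAt ℝ g q :=
    (hg.contDiffAt (isOpen_affCarrier.mem_nhds hq)).differentiableAt (by simp)
  rw [fderiv_comp p (hd hΘs (hΦ.mapsTo hp)) (hd hΦs hp), ContinuousLinearMap.comp_apply,
    Function.comp_apply, hΘn _ (hΦ.mapsTo hp), hΦn p hp]

/-- An injective linear map preserving the orthonormal frames up to signs preserves the norms. -/
theorem AffARS.enorm_eq_of_map_frame {S T : AffARS} {p q : ℝ × ℝ} {L : ℝ × ℝ →L[ℝ] ℝ × ℝ}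
    (hL : Function.Injective L) {s₁ s₂ : ℝ} (hs₁ : s₁ ^ 2 = 1) (hs₂ : s₂ ^ 2 = 1)
    (hlin : L (S.lin p) = s₁ • T.lin q) (hB : L (S.B p) = s₂ • T.B q) (v : ℝ × ℝ) :
    T.enorm q (L v) = S.enorm p v := by
  have hframe (c u : ℝ) :
      L (c • S.lin p + u • S.B p) = (s₁ * c) • T.lin q + (s₂ * u) • T.B q := by
    rw [map_add, map_smul, map_smul, hlin, hB, smul_smul, smul_smul, mul_comm c, mul_comm u]
  have hnorm (c u : ℝ) : (s₁ * c) ^ 2 + (s₂ * u) ^ 2 = c ^ 2 + u ^ 2 := by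
    linear_combination c ^ 2 * hs₁ + u ^ 2 * hs₂
  have hinv₁ (c : ℝ) : s₁ * (s₁ * c) = c := by linear_combination c * hs₁
  have hinv₂ (u : ℝ) : s₂ * (s₂ * u) = u := by linear_combination u * hs₂
  rw [AffARS.enorm, AffARS.enorm]
  congr 1
  ext r
  constructor
  · rintro ⟨c, u, h, rfl⟩
    exact ⟨s₁ * c, s₂ * u, hL (by rw [hframe, hinv₁, hinv₂, h]), by rw [hnorm]⟩
  · rintro ⟨c, u, rfl, rfl⟩
    exact ⟨s₁ * c, s₂ * u, (hframe c u).symm, by rw [hnorm]⟩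

/-- The linear part of the automorphism `(x, y) ↦ (x, dy + c(x - 1))`. -/
def shearCLM (c d : ℝ) : ℝ × ℝ →L[ℝ] ℝ × ℝ :=
  (ContinuousLinearMap.fst ℝ ℝ ℝ).prod
    (d • ContinuousLinearMap.snd ℝ ℝ ℝ + c • ContinuousLinearMap.fst ℝ ℝ ℝ)

theorem shearCLM_apply (c d : ℝ) (v : ℝ × ℝ) : shearCLM c d v = (v.1, d * v.2 + c * v.1) := rfl

/-- Isometry through the automorphism `(x, y) ↦ (x, dy + c(x - 1))`. -/
theorem affIsometric_of_shear {S T : AffARS} {c d s₁ s₂ : ℝ} (hd : d ≠ 0)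
    (hs₁ : s₁ ^ 2 = 1) (hs₂ : s₂ ^ 2 = 1) (hα : S.α = s₂ * T.α)
    (hβ : d * S.β + c * S.α = s₂ * T.β) (ha : d * S.a = s₁ * (T.a + T.b * c))
    (hb : S.b = s₁ * T.b) : AffIsometric S T := by
  have hinv : InvOn (fun p : ℝ × ℝ => (p.1, d⁻¹ * p.2 - d⁻¹ * c * (p.1 - 1)))
      (fun p => (p.1, d * p.2 + c * (p.1 - 1))) affCarrier affCarrier := by
    constructor <;> intro p _ <;> ext <;> simp <;> field_simp <;> ring
  refine ⟨fun p => (p.1, d * p.2 + c * (p.1 - 1)),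
    ⟨hinv.bijOn (fun p hp => hp) fun p hp => hp, ?_, _, hinv, ?_⟩, fun p _ v => ?_⟩
  · exact ContDiff.contDiffOn (by fun_prop)
  · exact ContDiff.contDiffOn (by fun_prop)
  · have hderiv : HasFDerivAt (fun p : ℝ × ℝ => (p.1, d * p.2 + c * (p.1 - 1)))
        (shearCLM c d) p :=
      hasFDerivAt_fst.prodMk ((hasFDerivAt_snd.const_mul d).add
        ((hasFDerivAt_fst.sub_const 1).const_mul c))
    rw [hderiv.fderiv]
    refine AffARS.enorm_eq_of_map_frame ?_ hs₁ hs₂ ?_ ?_ v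
    · intro v w hvw
      simp only [shearCLM_apply, Prod.mk.injEq] at hvw
      obtain ⟨h₁, h₂⟩ := hvw
      rw [h₁] at h₂
      exact Prod.ext h₁ (mul_left_cancel₀ hd (add_right_cancel h₂))
    · ext
      · simp [shearCLM_apply, AffARS.lin]
      · simp only [shearCLM_apply, AffARS.lin, Prod.smul_snd, smul_eq_mul]
        linear_combination (p.1 - 1) * ha + d * p.2 * hb
    · ext
      · simp only [shearCLM_apply, AffARS.B, affX, affY, Prod.smul_fst, Prod.fst_add, smul_eq_mul]
        linear_combination p.1 * hα
      · simp only [shearCLM_apply, AffARS.B, affX, affY, Prod.smul_fst, Prod.fst_add,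
          Prod.smul_snd, Prod.snd_add, smul_eq_mul]
        linear_combination p.1 * hβ

theorem exists_sign_mul_eq_abs (x : ℝ) : ∃ s : ℝ, s ^ 2 = 1 ∧ x = s * |x| := by
  rcases abs_choice x with h | h
  · exact ⟨1, by norm_num, by rw [h]; ring⟩
  · exact ⟨-1, by norm_num, by rw [h]; ring⟩

theorem AffARS.IsARS.exists_shear {S : AffARS} (hS : S.IsARS) :
    AffIsometric S (AffARS.mk |S.α| 0 1 |S.b|) ∧ AffIsometric (AffARS.mk |S.α| 0 1 |S.b|) S := by
  have hα : S.α ≠ 0 := left_ne_zero_of_mul hS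
  have hdet : S.a * S.α + S.b * S.β ≠ 0 := right_ne_zero_of_mul hS
  obtain ⟨s₂, hs₂, hαs⟩ := exists_sign_mul_eq_abs S.α
  obtain ⟨s₁, hs₁, hbs⟩ := exists_sign_mul_eq_abs S.b
  have hs₁0 : s₁ ≠ 0 := by rintro rfl; simp at hs₁
  set d : ℝ := s₁ * S.α / (S.a * S.α + S.b * S.β) with hd
  have hd0 : d ≠ 0 := div_ne_zero (mul_ne_zero hs₁0 hα) hdet
  have hdmul : d * (S.a * S.α + S.b * S.β) = s₁ * S.α := div_mul_cancel₀ _ hdet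
  set c : ℝ := -(d * S.β) / S.α with hc
  have hcmul : c * S.α = -(d * S.β) := div_mul_cancel₀ _ hα
  have hda : d * S.a = s₁ + S.b * c :=
    mul_right_cancel₀ hα (by linear_combination hdmul - S.b * hcmul)
  have hα' : |S.α| = s₂ * S.α := by linear_combination -s₂ * hαs - |S.α| * hs₂
  have hb' : |S.b| = s₁ * S.b := by linear_combination -s₁ * hbs - |S.b| * hs₁
  constructor
  · refine affIsometric_of_shear (c := c) hd0 hs₁ hs₂ hαs ?_ ?_ hbs
    · simp only
      linear_combination hcmul
    · simp only
      linear_combination hda + c * hbs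
  · refine affIsometric_of_shear (c := -c / d) (d := d⁻¹) (inv_ne_zero hd0) hs₁ hs₂ hα' ?_ ?_ hb'
    · simp only
      rw [hα']
      field_simp
      linear_combination -s₂ * hcmul
    · simp only
      field_simp
      linear_combination -s₁ * hda - hs₁

/-- Every ARS on `Aff₊(2)` is isometric to one and only one of the
ARSs defined by the derivation `D = [[0,0],[1,b]]` and the field `B = αX`, with
`α > 0` and `b ≥ 0`. -/
theorem aff_classification_by_isometries (S : AffARS) (hS : S.IsARS) :
    ∃ α b : ℝ, 0 < α ∧ 0 ≤ b ∧ (AffARS.mk α 0 1 b).IsARS ∧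
      AffIsometric S (AffARS.mk α 0 1 b) ∧
      ∀ α' b' : ℝ, 0 < α' → 0 ≤ b' → AffIsometric S (AffARS.mk α' 0 1 b') →
        α' = α ∧ b' = b := by
  obtain ⟨hto, hfrom⟩ := hS.exists_shear
  have hα : 0 < |S.α| := abs_pos.2 (left_ne_zero_of_mul hS)
  refine ⟨|S.α|, |S.b|, hα, abs_nonneg _, ?_, hto, fun α' b' hα' hb' h => ?_⟩
  · simpa [AffARS.IsARS] using hα.ne'
  · obtain ⟨h₁, h₂⟩ := parameters_eq_of_isometry hα hα' (abs_nonneg _) hb' (hfrom.trans h)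
    exact ⟨h₁.symm, h₂.symm⟩

end
end

section
/- Every almost-Riemannian structure on the 3-dimensional Heisenberg group G whose distribution Δ is a Lie subalgebra is isometric to an ARS whose orthonormal frame is {X, Z, 𝒳} and whose derivation D has, in the basis (X,Y,Z), the form D = [[0,b,0],[c,d,0],[0,f,d]] with c > 0 and d, f ≥ 0. Moreover, two different ARSs of this normalized form are not isometric. -/
open Set ENNReal

noncomputable section

/-- The 3-dimensional Heisenberg group, identified in coordinates with `ℝ³`:
`(x,y,z)` corresponds to the unipotent matrix `[[1,x,z],[0,1,y],[0,0,1]]`. -/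
abbrev Heis : Type := ℝ × ℝ × ℝ

/-- The group product of the Heisenberg group in coordinates. -/
def heisMul (p q : Heis) : Heis := (p.1 + q.1, p.2.1 + q.2.1, p.2.2 + q.2.2 + p.1 * q.2.1)

/-- The identity element. -/
def heisOne : Heis := (0, 0, 0)

/-- The group inverse. -/
def heisInv (p : Heis) : Heis := (-p.1, -p.2.1, -p.2.2 + p.1 * p.2.1)

/-- The left translation by `g`. -/
def heisLT (g : Heis) : Heis → Heis := fun p => heisMul g p

/-- The left-invariant vector field `X`. -/
def heisX : Heis → Heis := fun _ => (1, 0, 0)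

/-- The left-invariant vector field `Y`. -/
def heisY (p : Heis) : Heis := (0, 1, p.1)

/-- The left-invariant vector field `Z`. -/
def heisZ : Heis → Heis := fun _ => (0, 0, 1)

/-- The left-invariant vector field with coordinates `u = (u₁,u₂,u₃)` in the basis
`(X,Y,Z)` of the Lie algebra. -/
def heisLI (u : Heis) : Heis → Heis := fun p => u.1 • heisX p + u.2.1 • heisY p + u.2.2 • heisZ p

/-- The Lie bracket of the Heisenberg Lie algebra in the basis `(X,Y,Z)`:
`[X,Y] = Z` and all the other brackets of basis elements vanish. -/
def heisBracket (u v : Heis) : Heis := (0, 0, u.1 * v.2.1 - v.1 * u.2.1)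

/-- The data of an ARS on the Heisenberg group: two left-invariant vector fields
`B₁, B₂` (given by their coordinates in the basis `(X,Y,Z)`) and the linear vector
field associated to the derivation `D = [[a,b,0],[c,d,0],[e,f,a+d]]`. -/
structure HeisARS where
  B1 : Heis
  B2 : Heis
  a : ℝ
  b : ℝ
  c : ℝ
  d : ℝ
  e : ℝ
  f : ℝ

/-- The linear vector field associated to the derivation `D = [[a,b,0],[c,d,0],[e,f,a+d]]`:
`𝒳(x,y,z) = (ax+by)∂/∂x + (cx+dy)∂/∂y + (ex+fy+(a+d)z+½cx²+½by²)∂/∂z`. -/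
def HeisARS.lin (S : HeisARS) (p : Heis) : Heis :=
  (S.a * p.1 + S.b * p.2.1,
   S.c * p.1 + S.d * p.2.1,
   S.e * p.1 + S.f * p.2.1 + (S.a + S.d) * p.2.2 + S.c * p.1 ^ 2 / 2 + S.b * p.2.1 ^ 2 / 2)

/-- The first left-invariant vector field of the frame. -/
def HeisARS.V1 (S : HeisARS) : Heis → Heis := heisLI S.B1

/-- The second left-invariant vector field of the frame. -/
def HeisARS.V2 (S : HeisARS) : Heis → Heis := heisLI S.B2

/-- The left-invariant distribution `Δ = span{B₁, B₂}` (at the identity). -/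
def HeisARS.Delta (S : HeisARS) : Submodule ℝ Heis := Submodule.span ℝ {S.B1, S.B2}

/-- The Lie bracket of two vector fields on `ℝ³`, in coordinates. -/
def vfBracketH (V W : Heis → Heis) : Heis → Heis := fun p =>
  fderiv ℝ W p (V p) - fderiv ℝ V p (W p)

/-- The Lie algebra of vector fields generated by a family `F` of vector fields. -/
inductive HeisLieGen (F : Set (Heis → Heis)) : (Heis → Heis) → Prop
  | base {V : Heis → Heis} : V ∈ F → HeisLieGen F V
  | add {V W : Heis → Heis} : HeisLieGen F V → HeisLieGen F W → HeisLieGen F (V + W)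
  | smul (c : ℝ) {V : Heis → Heis} : HeisLieGen F V → HeisLieGen F (c • V)
  | bracket {V W : Heis → Heis} : HeisLieGen F V → HeisLieGen F W → HeisLieGen F (vfBracketH V W)

/-- The conditions for the data to define an ARS: the frame `{𝒳, B₁, B₂}` has full
rank on a nonempty subset of `G` and satisfies the rank condition. -/
def HeisARS.IsARS (S : HeisARS) : Prop :=
  (∃ p : Heis, Submodule.span ℝ {S.lin p, S.V1 p, S.V2 p} = ⊤) ∧
  ∀ p : Heis, Submodule.span ℝ
    {v : Heis | ∃ V : Heis → Heis, HeisLieGen {S.lin, S.V1, S.V2} V ∧ V p = v} = ⊤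

/-- The almost-Riemannian norm of a tangent vector `v` at `p`: the infimum of
`√(c² + u₁² + u₂²)` over the decompositions `v = c·𝒳(p) + u₁·B₁(p) + u₂·B₂(p)`,
infinite if there is no such decomposition. -/
def HeisARS.enorm (S : HeisARS) (p v : Heis) : ℝ≥0∞ :=
  sInf {r : ℝ≥0∞ | ∃ c u1 u2 : ℝ, c • S.lin p + u1 • S.V1 p + u2 • S.V2 p = v ∧
    r = ENNReal.ofReal (Real.sqrt (c ^ 2 + u1 ^ 2 + u2 ^ 2))}

/-- A diffeomorphism of the Heisenberg group in coordinates: a smooth bijection of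
`ℝ³` with smooth inverse. -/
structure IsHeisDiffeo (Φ : Heis → Heis) : Prop where
  bijective : Function.Bijective Φ
  smooth : ContDiff ℝ (⊤ : ℕ∞) Φ
  exists_smooth_inv : ∃ Ψ : Heis → Heis,
    Function.LeftInverse Ψ Φ ∧ Function.RightInverse Ψ Φ ∧ ContDiff ℝ (⊤ : ℕ∞) Ψ

/-- An isometry from the ARS `S` onto the ARS `S'` on the Heisenberg group. -/
def IsHeisIsometry (S S' : HeisARS) (Φ : Heis → Heis) : Prop :=
  IsHeisDiffeo Φ ∧ ∀ p v : Heis, S'.enorm (Φ p) (fderiv ℝ Φ p v) = S.enorm p v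

/-- Two ARSs on the Heisenberg group are isometric if there is an isometry from one
onto the other. -/
def HeisIsometric (S S' : HeisARS) : Prop := ∃ Φ, IsHeisIsometry S S' Φ

/-- The set `Z_𝒳` of singularities of the linear vector field of an ARS. -/
def HeisARS.linSingularities (S : HeisARS) : Set Heis := {g | S.lin g = 0}

/-- The coordinates of the basis vectors `X`, `Y`, `Z` of the Heisenberg Lie algebra. -/
def XLv : Heis := (1, 0, 0)
def YLv : Heis := (0, 1, 0)
def ZLv : Heis := (0, 0, 1)

/-- The normalized ARS of the subalgebra case: orthonormal frame `{X, Z, 𝒳}` and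
derivation `D = [[0,b,0],[c,d,0],[0,f,d]]`. -/
def subalgNormal (b c d f : ℝ) : HeisARS := ⟨XLv, ZLv, 0, b, c, d, 0, f⟩

/-- The algebra of smooth real functions on `ℝ³`. -/
def Smooth3 : Subalgebra ℝ (Heis → ℝ) where
  carrier := {f | ContDiff ℝ (⊤ : ℕ∞) f}
  mul_mem' {f g} (hf : ContDiff ℝ (⊤ : ℕ∞) f) (hg : ContDiff ℝ (⊤ : ℕ∞) g) :=
    show ContDiff ℝ (⊤ : ℕ∞) fun p => f p * g p from hf.mul hg
  add_mem' {f g} (hf : ContDiff ℝ (⊤ : ℕ∞) f) (hg : ContDiff ℝ (⊤ : ℕ∞) g) :=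
    show ContDiff ℝ (⊤ : ℕ∞) fun p => f p + g p from hf.add hg
  algebraMap_mem' r := show ContDiff ℝ (⊤ : ℕ∞) fun _ : Heis => r from contDiff_const

namespace Smooth3

/-- The directional derivative of a smooth function along a constant vector. -/
def pd (v : Heis) (f : Smooth3) : Smooth3 :=
  ⟨fun p => fderiv ℝ f.1 p v, by
    have hf : ContDiff ℝ (⊤ : ℕ∞) f.1 := f.2
    exact (hf.fderiv_right (m := ((⊤ : ℕ∞) : WithTop ℕ∞)) (by simp)).clm_apply contDiff_const⟩

theorem contDiff (f : Smooth3) : ContDiff ℝ (⊤ : ℕ∞) f.1 := f.2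

theorem differentiable (f : Smooth3) : Differentiable ℝ f.1 :=
  (contDiff f).differentiable (by simp)

theorem pd_apply (v : Heis) (f : Smooth3) (p : Heis) : (pd v f).1 p = fderiv ℝ f.1 p v := rfl

theorem pd_add (v : Heis) (f g : Smooth3) : pd v (f + g) = pd v f + pd v g := by
  ext p
  have := fderiv_add (differentiable f p) (differentiable g p)
  exact DFunLike.congr_fun this v

theorem pd_mul (v : Heis) (f g : Smooth3) : pd v (f * g) = pd v f * g + f * pd v g := by
  ext p
  have := fderiv_mul (differentiable f p) (differentiable g p)
  have h2 := DFunLike.congr_fun this v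
  simp only [add_apply, smul_apply, smul_eq_mul] at h2
  change fderiv ℝ (f.1 * g.1) p v = fderiv ℝ f.1 p v * g.1 p + f.1 p * fderiv ℝ g.1 p v
  rw [h2]; ring

theorem pd_smul (v : Heis) (a : ℝ) (f : Smooth3) : pd v (a • f) = a • pd v f := by
  ext p
  have := fderiv_const_smul (differentiable f p) a
  exact DFunLike.congr_fun this v

theorem pd_comm (v w : Heis) (f : Smooth3) : pd v (pd w f) = pd w (pd v f) := by
  ext p
  have hsymm : IsSymmSndFDerivAt ℝ f.1 p :=
    ((contDiff f).contDiffAt).isSymmSndFDerivAt (by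
      simpa using WithTop.coe_le_coe.2 (le_top : (2 : ℕ∞) ≤ ⊤))
  have hd : DifferentiableAt ℝ (fderiv ℝ f.1) p :=
    ((contDiff f).fderiv_right (m := ((⊤ : ℕ∞) : WithTop ℕ∞)) (by simp)).differentiable (by simp) p
  have key : ∀ u u' : Heis, fderiv ℝ (fun q => fderiv ℝ f.1 q u) p u' =
      fderiv ℝ (fderiv ℝ f.1) p u' u := by
    intro u u'
    rw [fderiv_clm_apply hd (by fun_prop)]
    simp
  change fderiv ℝ (fun q => fderiv ℝ f.1 q w) p v = fderiv ℝ (fun q => fderiv ℝ f.1 q v) p w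
  rw [key, key]
  exact hsymm.eq v w

/-- The partial derivative in the first coordinate. -/
abbrev dr : Smooth3 → Smooth3 := pd (1, 0, 0)
/-- The partial derivative in the second coordinate. -/
abbrev dt : Smooth3 → Smooth3 := pd (0, 1, 0)
/-- The partial derivative in the third coordinate. -/
abbrev dz : Smooth3 → Smooth3 := pd (0, 0, 1)

/-- The first coordinate. -/
def cr : Smooth3 := ⟨fun p => p.1, (contDiff_fst : ContDiff ℝ (⊤ : ℕ∞) _)⟩
/-- The second coordinate. -/
def ct : Smooth3 := ⟨fun p => p.2.1,
  (contDiff_fst.comp contDiff_snd : ContDiff ℝ (⊤ : ℕ∞) fun p : Heis => p.2.1)⟩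
/-- The third coordinate. -/
def cz : Smooth3 := ⟨fun p => p.2.2,
  (contDiff_snd.comp contDiff_snd : ContDiff ℝ (⊤ : ℕ∞) fun p : Heis => p.2.2)⟩

theorem dr_cr : dr cr = 1 := by
  ext p
  change fderiv ℝ (fun p : Heis => p.1) p (1, 0, 0) = 1
  simp [fderiv_fst]

theorem dr_ct : dr ct = 0 := by
  ext p
  change fderiv ℝ (fun p : Heis => p.2.1) p (1, 0, 0) = 0
  rw [fderiv.fst (by fun_prop), fderiv_snd]
  simp

theorem dr_cz : dr cz = 0 := by
  ext p
  change fderiv ℝ (fun p : Heis => p.2.2) p (1, 0, 0) = 0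
  rw [fderiv.snd (by fun_prop), fderiv_snd]
  simp

theorem pd_one (v : Heis) : pd v 1 = 0 := by
  ext p
  change fderiv ℝ (fun _ : Heis => (1 : ℝ)) p v = 0
  simp

theorem pd_zero (v : Heis) : pd v 0 = 0 := by
  ext p
  change fderiv ℝ (fun _ : Heis => (0 : ℝ)) p v = 0
  simp

/-- The `n`-th Taylor coefficient at `r = 0` in the first coordinate `r`, as a function of
the two other coordinates. -/
def tc (n : ℕ) (f : Smooth3) (t z : ℝ) : ℝ := (dr^[n] f).1 (0, t, z) / n.factorial

theorem tc_add (n : ℕ) (f g : Smooth3) (t z : ℝ) :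
    tc n (f + g) t z = tc n f t z + tc n g t z := by
  have : ∀ n, ∀ f g : Smooth3, dr^[n] (f + g) = dr^[n] f + dr^[n] g := by
    intro n
    induction n with
    | zero => intro f g; rfl
    | succ n ih => intro f g; simp only [Function.iterate_succ_apply, pd_add, ih]
  rw [tc, this]
  exact add_div _ _ _

theorem tc_smul (n : ℕ) (a : ℝ) (f : Smooth3) (t z : ℝ) :
    tc n (a • f) t z = a * tc n f t z := by
  have : ∀ n, ∀ f : Smooth3, dr^[n] (a • f) = a • dr^[n] f := by
    intro n
    induction n with
    | zero => intro f; rfl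
    | succ n ih => intro f; simp only [Function.iterate_succ_apply, pd_smul, ih]
  rw [tc, this]
  exact mul_div_assoc _ _ _

theorem val_add (f g : Smooth3) (p : Heis) : (f + g).1 p = f.1 p + g.1 p := rfl
theorem val_mul (f g : Smooth3) (p : Heis) : (f * g).1 p = f.1 p * g.1 p := rfl
theorem val_one (p : Heis) : (1 : Smooth3).1 p = 1 := rfl
theorem val_zero (p : Heis) : (0 : Smooth3).1 p = 0 := rfl
theorem val_smul (a : ℝ) (f : Smooth3) (p : Heis) : (a • f).1 p = a * f.1 p := rfl

theorem tc_zero_mul (f g : Smooth3) (t z : ℝ) :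
    tc 0 (f * g) t z = tc 0 f t z * tc 0 g t z := by
  simp [tc, val_mul]

theorem tc_one_mul (f g : Smooth3) (t z : ℝ) :
    tc 1 (f * g) t z = tc 0 f t z * tc 1 g t z + tc 1 f t z * tc 0 g t z := by
  simp only [tc, Function.iterate_succ_apply, Function.iterate_zero_apply, pd_mul,
    val_add, val_mul, Nat.factorial]
  push_cast; ring

theorem tc_two_mul (f g : Smooth3) (t z : ℝ) :
    tc 2 (f * g) t z =
      tc 0 f t z * tc 2 g t z + tc 1 f t z * tc 1 g t z + tc 2 f t z * tc 0 g t z := by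
  simp only [tc, Function.iterate_succ_apply, Function.iterate_zero_apply, pd_add, pd_mul,
    val_add, val_mul, Nat.factorial]
  push_cast; ring

theorem tc_three_mul (f g : Smooth3) (t z : ℝ) :
    tc 3 (f * g) t z =
      tc 0 f t z * tc 3 g t z + tc 1 f t z * tc 2 g t z + tc 2 f t z * tc 1 g t z +
        tc 3 f t z * tc 0 g t z := by
  simp only [tc, Function.iterate_succ_apply, Function.iterate_zero_apply, pd_add, pd_mul,
    val_add, val_mul, Nat.factorial]
  push_cast; ring

theorem tc_four_mul (f g : Smooth3) (t z : ℝ) :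
    tc 4 (f * g) t z =
      tc 0 f t z * tc 4 g t z + tc 1 f t z * tc 3 g t z + tc 2 f t z * tc 2 g t z +
        tc 3 f t z * tc 1 g t z + tc 4 f t z * tc 0 g t z := by
  simp only [tc, Function.iterate_succ_apply, Function.iterate_zero_apply, pd_add, pd_mul,
    val_add, val_mul, Nat.factorial]
  push_cast; ring

theorem tc_dr (n : ℕ) (f : Smooth3) (t z : ℝ) :
    tc n (dr f) t z = (n + 1) * tc (n + 1) f t z := by
  have : (n.factorial : ℝ) ≠ 0 := by positivity
  simp only [tc, Function.iterate_succ_apply, Nat.factorial_succ]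
  push_cast
  field_simp

theorem dr_iterate_pd (v : Heis) (n : ℕ) (f : Smooth3) : dr^[n] (pd v f) = pd v (dr^[n] f) := by
  induction n generalizing f with
  | zero => rfl
  | succ n ih => simp only [Function.iterate_succ_apply, pd_comm (1, 0, 0) v, ih]

theorem hasDerivAt_tc_dt (n : ℕ) (f : Smooth3) (t z : ℝ) :
    HasDerivAt (fun t => tc n f t z) (tc n (dt f) t z) t := by
  rw [tc, dr_iterate_pd]
  refine HasDerivAt.div_const ?_ _
  have h1 := (differentiable (dr^[n] f) (0, t, z)).hasFDerivAt
  have h2 : HasDerivAt (fun t : ℝ => ((0, t, z) : Heis)) (0, 1, 0) t :=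
    (hasDerivAt_const t (0 : ℝ)).prodMk ((hasDerivAt_id t).prodMk (hasDerivAt_const t z))
  exact h1.comp_hasDerivAt t h2

theorem hasDerivAt_tc_dz (n : ℕ) (f : Smooth3) (t z : ℝ) :
    HasDerivAt (fun z => tc n f t z) (tc n (dz f) t z) z := by
  rw [tc, dr_iterate_pd]
  refine HasDerivAt.div_const ?_ _
  have h1 := (differentiable (dr^[n] f) (0, t, z)).hasFDerivAt
  have h2 : HasDerivAt (fun z : ℝ => ((0, t, z) : Heis)) (0, 0, 1) z :=
    (hasDerivAt_const z (0 : ℝ)).prodMk ((hasDerivAt_const z t).prodMk (hasDerivAt_id z))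
  exact h1.comp_hasDerivAt z h2

theorem continuous_tc (n : ℕ) (f : Smooth3) : Continuous fun q : ℝ × ℝ => tc n f q.1 q.2 := by
  have := (contDiff (dr^[n] f)).continuous
  unfold tc
  fun_prop

theorem tc_cr (t z : ℝ) : tc 0 cr t z = 0 ∧ tc 1 cr t z = 1 ∧ ∀ n, tc (n + 2) cr t z = 0 := by
  refine ⟨by simp [tc, cr], by simp [tc, dr_cr, val_one], fun n => ?_⟩
  have h0 : ∀ n, dr^[n] (0 : Smooth3) = 0 := fun n =>
    Function.iterate_fixed (pd_zero _) n
  simp [tc, Function.iterate_succ_apply, dr_cr, pd_one, h0, val_zero]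

theorem tc_ct (t z : ℝ) : tc 0 ct t z = t ∧ ∀ n, tc (n + 1) ct t z = 0 := by
  refine ⟨by simp [tc, ct], fun n => ?_⟩
  have h0 : ∀ n, dr^[n] (0 : Smooth3) = 0 := fun n =>
    Function.iterate_fixed (pd_zero _) n
  simp [tc, Function.iterate_succ_apply, dr_ct, h0, val_zero]

theorem tc_cz (t z : ℝ) : tc 0 cz t z = z ∧ ∀ n, tc (n + 1) cz t z = 0 := by
  refine ⟨by simp [tc, cz], fun n => ?_⟩
  have h0 : ∀ n, dr^[n] (0 : Smooth3) = 0 := fun n =>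
    Function.iterate_fixed (pd_zero _) n
  simp [tc, Function.iterate_succ_apply, dr_cz, h0, val_zero]

theorem tc_one (t z : ℝ) : tc 0 1 t z = 1 ∧ ∀ n, tc (n + 1) 1 t z = 0 := by
  refine ⟨by simp [tc, val_one], fun n => ?_⟩
  have h0 : ∀ n, dr^[n] (0 : Smooth3) = 0 := fun n =>
    Function.iterate_fixed (pd_zero _) n
  simp [tc, Function.iterate_succ_apply, pd_one, h0, val_zero]

/-- The last component of the linear field of the model structure in adapted coordinates. -/
def om (B c d F : ℝ) (r t z : Smooth3) : Smooth3 :=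
  d • z + F • t + (c / 2) • (r * r + B • (t * t))

/-- The derivation by the linear field
`(Bt + dr) ∂r + r ∂t + (dz + Ft + c (r² + Bt²) / 2) ∂z` of the model structure. -/
def W (B c d F : ℝ) (f : Smooth3) : Smooth3 :=
  (B • ct + d • cr) * dr f + cr * dt f + om B c d F cr ct cz * dz f

theorem tc_W (B c d F : ℝ) (f : Smooth3) (t z : ℝ) :
    tc 0 (W B c d F f) t z = B * t * tc 1 f t z +
      (d * z + F * t + c * B * t ^ 2 / 2) * tc 0 (dz f) t z ∧
    tc 1 (W B c d F f) t z = 2 * B * t * tc 2 f t z + d * tc 1 f t z + tc 0 (dt f) t z +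
      (d * z + F * t + c * B * t ^ 2 / 2) * tc 1 (dz f) t z ∧
    tc 2 (W B c d F f) t z = 3 * B * t * tc 3 f t z + 2 * d * tc 2 f t z + tc 1 (dt f) t z +
      (d * z + F * t + c * B * t ^ 2 / 2) * tc 2 (dz f) t z + c / 2 * tc 0 (dz f) t z ∧
    tc 3 (W B c d F f) t z = 4 * B * t * tc 4 f t z + 3 * d * tc 3 f t z + tc 2 (dt f) t z +
      (d * z + F * t + c * B * t ^ 2 / 2) * tc 3 (dz f) t z + c / 2 * tc 1 (dz f) t z := by
  obtain ⟨r0, r1, r2⟩ := tc_cr t z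
  obtain ⟨t0, t1⟩ := tc_ct t z
  obtain ⟨z0, z1⟩ := tc_cz t z
  have r2' := r2 0
  have r3' := r2 1
  have t1' := t1 0
  have t2' := t1 1
  have t3' := t1 2
  have z1' := z1 0
  have z2' := z1 1
  have z3' := z1 2
  norm_num at r2' r3' t1' t2' t3' z1' z2' z3'
  simp only [W, om, tc_add, tc_zero_mul, tc_one_mul, tc_two_mul, tc_three_mul, tc_smul, tc_dr,
    r0, r1, r2', r3', t0, t1', t2', t3', z0, z1', z2', z3']
  push_cast
  refine ⟨?_, ?_, ?_, ?_⟩ <;> ring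

theorem tc_dt_eq_zero {n : ℕ} {f : Smooth3} {a : ℝ} (h : ∀ t z, tc n f t z = a) (t z : ℝ) :
    tc n (dt f) t z = 0 := by
  have h1 := hasDerivAt_tc_dt n f t z
  simp only [h] at h1
  exact h1.unique (hasDerivAt_const t a)

theorem tc_dz_eq_zero {n : ℕ} {f : Smooth3} {t a : ℝ} (h : ∀ z, tc n f t z = a) (z : ℝ) :
    tc n (dz f) t z = 0 := by
  have h1 := hasDerivAt_tc_dz n f t z
  simp only [h] at h1
  exact h1.unique (hasDerivAt_const z a)

theorem tc_eq_linear_dt {n : ℕ} {f : Smooth3} {z a : ℝ} (h : ∀ t, tc n (dt f) t z = a) (t : ℝ) :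
    tc n f t z = a * t + tc n f 0 z := by
  have hd : ∀ s, HasDerivAt (fun s => tc n f s z - a * s) 0 s := fun s => by
    have := (hasDerivAt_tc_dt n f s z).sub ((hasDerivAt_id s).const_mul a)
    rw [h, mul_one, sub_self] at this
    exact this
  have := is_const_of_deriv_eq_zero (fun s => (hd s).differentiableAt) (fun s => (hd s).deriv) t 0
  simp only [mul_zero, sub_zero] at this
  linarith

theorem tc_eq_linear_dz {n : ℕ} {f : Smooth3} {t a : ℝ} (h : ∀ z, tc n (dz f) t z = a) (z : ℝ) :
    tc n f t z = a * z + tc n f t 0 := by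
  have hd : ∀ s, HasDerivAt (fun s => tc n f t s - a * s) 0 s := fun s => by
    have := (hasDerivAt_tc_dz n f t s).sub ((hasDerivAt_id s).const_mul a)
    rw [h, mul_one, sub_self] at this
    exact this
  have := is_const_of_deriv_eq_zero (fun s => (hd s).differentiableAt) (fun s => (hd s).deriv) z 0
  simp only [mul_zero, sub_zero] at this
  linarith

theorem exists_eq_of_sq_eq_one {n : ℕ} {f : Smooth3} (h : ∀ t z, tc n f t z ^ 2 = 1) :
    ∃ a : ℝ, a ^ 2 = 1 ∧ ∀ t z, tc n f t z = a := by
  rcases (isPreconnected_univ (α := ℝ × ℝ)).eq_or_eq_neg_of_sq_eq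
      (continuous_tc n f).continuousOn (continuous_const (y := (1 : ℝ))).continuousOn
      (fun q _ => by simpa using h q.1 q.2) (fun _ => one_ne_zero) with h1 | h1
  · exact ⟨1, by norm_num, fun t z => h1 (mem_univ (t, z))⟩
  · exact ⟨-1, by norm_num, fun t z => h1 (mem_univ (t, z))⟩

/-- The map with components `R, T, C` intertwines the cometrics of two model structures. -/
structure IsModelIsometry (B c d F B' c' d' F' : ℝ) (R T C : Smooth3) : Prop where
  RR : dr R * dr R + dz R * dz R + W B c d F R * W B c d F R =
    1 + (B' • T + d' • R) * (B' • T + d' • R)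
  RT : dr R * dr T + dz R * dz T + W B c d F R * W B c d F T = (B' • T + d' • R) * R
  TT : dr T * dr T + dz T * dz T + W B c d F T * W B c d F T = R * R
  RC : dr R * dr C + dz R * dz C + W B c d F R * W B c d F C =
    (B' • T + d' • R) * om B' c' d' F' R T C
  TC : dr T * dr C + dz T * dz C + W B c d F T * W B c d F C = R * om B' c' d' F' R T C
  CC : dr C * dr C + dz C * dz C + W B c d F C * W B c d F C =
    1 + om B' c' d' F' R T C * om B' c' d' F' R T C

theorem tc_om (B c d F : ℝ) (R T C : Smooth3) (t z : ℝ) (h0 : tc 0 R t z = 0)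
    (h1 : tc 1 T t z = 0) :
    tc 0 (om B c d F R T C) t z =
      d * tc 0 C t z + F * tc 0 T t z + c * B * tc 0 T t z ^ 2 / 2 ∧
    tc 1 (om B c d F R T C) t z = d * tc 1 C t z ∧
    tc 2 (om B c d F R T C) t z = d * tc 2 C t z + F * tc 2 T t z +
      c * (tc 1 R t z ^ 2 + 2 * B * tc 0 T t z * tc 2 T t z) / 2 := by
  simp only [om, tc_add, tc_smul, tc_zero_mul, tc_one_mul, tc_two_mul, h0, h1]
  refine ⟨?_, ?_, ?_⟩ <;> ring

theorem eq_zero_of_gram {a₁ a₂ b₁ b₂ c₁ c₂ p q u r w : ℝ}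
    (h1 : a₁ * a₁ + a₂ * a₂ + (p * a₁ + q * a₂) * (p * a₁ + q * a₂) = 1 + u * u)
    (h2 : a₁ * b₁ + a₂ * b₂ + (p * a₁ + q * a₂) * (p * b₁ + q * b₂) = u * r)
    (h3 : b₁ * b₁ + b₂ * b₂ + (p * b₁ + q * b₂) * (p * b₁ + q * b₂) = r * r)
    (h4 : a₁ * c₁ + a₂ * c₂ + (p * a₁ + q * a₂) * (p * c₁ + q * c₂) = u * w)
    (h5 : b₁ * c₁ + b₂ * c₂ + (p * b₁ + q * b₂) * (p * c₁ + q * c₂) = r * w)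
    (h6 : c₁ * c₁ + c₂ * c₂ + (p * c₁ + q * c₂) * (p * c₁ + q * c₂) = 1 + w * w) : r = 0 := by
  have hdet : ∀ g₁₁ g₁₂ g₁₃ g₂₂ g₂₃ g₃₃ : ℝ,
      a₁ * a₁ + a₂ * a₂ + (p * a₁ + q * a₂) * (p * a₁ + q * a₂) = g₁₁ →
      a₁ * b₁ + a₂ * b₂ + (p * a₁ + q * a₂) * (p * b₁ + q * b₂) = g₁₂ →
      b₁ * b₁ + b₂ * b₂ + (p * b₁ + q * b₂) * (p * b₁ + q * b₂) = g₂₂ →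
      a₁ * c₁ + a₂ * c₂ + (p * a₁ + q * a₂) * (p * c₁ + q * c₂) = g₁₃ →
      b₁ * c₁ + b₂ * c₂ + (p * b₁ + q * b₂) * (p * c₁ + q * c₂) = g₂₃ →
      c₁ * c₁ + c₂ * c₂ + (p * c₁ + q * c₂) * (p * c₁ + q * c₂) = g₃₃ →
      g₁₁ * (g₂₂ * g₃₃ - g₂₃ * g₂₃) - g₁₂ * (g₁₂ * g₃₃ - g₂₃ * g₁₃) +
        g₁₃ * (g₁₂ * g₂₃ - g₂₂ * g₁₃) = 0 := by
    rintro _ _ _ _ _ _ rfl rfl rfl rfl rfl rfl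
    ring
  have := hdet _ _ _ _ _ _ h1 h2 h3 h4 h5 h6
  ring_nf at this
  exact pow_eq_zero_iff (two_ne_zero) |>.1 this

theorem first_order_relations {β β' R₁ T₂ τ' C₁ Cz ω Ω : ℝ}
    (h1 : R₁ ^ 2 + (β * R₁) ^ 2 = 1 + β' ^ 2)
    (h2 : R₁ * (2 * T₂) + β * R₁ * (2 * β * T₂ + τ') = β' * R₁)
    (h3 : (2 * T₂) ^ 2 + (2 * β * T₂ + τ') ^ 2 = R₁ ^ 2)
    (h4 : R₁ * C₁ + β * R₁ * (β * C₁ + ω * Cz) = β' * Ω)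
    (h5 : 2 * T₂ * C₁ + (2 * β * T₂ + τ') * (β * C₁ + ω * Cz) = R₁ * Ω)
    (h6 : C₁ ^ 2 + Cz ^ 2 + (β * C₁ + ω * Cz) ^ 2 = 1 + Ω ^ 2) :
    τ' ^ 2 = 1 ∧ 2 * T₂ * (1 + β ^ 2) + τ' * β = β' ∧ Cz ^ 2 = 1 ∧ Ω = τ' * R₁ * Cz * ω := by
  have hR : R₁ ≠ 0 := by
    rintro rfl
    nlinarith [sq_nonneg β']
  have hM' : 1 + β' ^ 2 ≠ 0 := by positivity
  have e2 : 2 * T₂ * (1 + β ^ 2) + τ' * β = β' := by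
    apply mul_left_cancel₀ hR
    linear_combination h2
  have e1 : τ' ^ 2 = 1 := by
    linear_combination (1 + β ^ 2) * h3 + h1 - (2 * T₂ * (1 + β ^ 2) + τ' * β + β') * e2
  have e4 : R₁ * (C₁ * (1 + β ^ 2)) = β' * Ω - R₁ * Cz * β * ω := by linear_combination h4
  have e5 : Ω = τ' * R₁ * Cz * ω := by
    linear_combination -((1 + β ^ 2) * R₁ * h5) + (R₁ * C₁ * (1 + β ^ 2) + R₁ * ω * Cz * β) * e2 +
      β' * e4 - Ω * h1
  refine ⟨e1, e2, mul_left_cancel₀ hM' ?_, e5⟩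
  linear_combination (1 + β ^ 2) * R₁ ^ 2 * h6 -
    (R₁ * (C₁ * (1 + β ^ 2)) + R₁ * Cz * β * ω + β' * Ω) * e4 - (Cz ^ 2 - 1 - Ω ^ 2) * h1 +
    (Ω + τ' * R₁ * Cz * ω) * e5 + R₁ ^ 2 * Cz ^ 2 * ω ^ 2 * e1

theorem tc_dr_zero (f : Smooth3) (t z : ℝ) : tc 0 (dr f) t z = tc 1 f t z := by
  simpa using tc_dr 0 f t z

theorem tc_zero_eq_zero {B c d F B' c' d' F' : ℝ} {R T C : Smooth3}
    (h : IsModelIsometry B c d F B' c' d' F' R T C) (t z : ℝ) : tc 0 R t z = 0 := by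
  have ev {f g : Smooth3} (e : f = g) : tc 0 f t z = tc 0 g t z := by rw [e]
  have h1 := ev h.RR
  have h2 := ev h.RT
  have h3 := ev h.TT
  have h4 := ev h.RC
  have h5 := ev h.TC
  have h6 := ev h.CC
  simp only [tc_add, tc_zero_mul, (tc_W B c d F _ t z).1, (tc_one t z).1, tc_smul, tc_dr_zero]
    at h1 h2 h3 h4 h5 h6
  exact eq_zero_of_gram h1 h2 h3 h4 h5 h6

theorem eq_zero_of_sq_poly {B c F G s : ℝ} (hc : c ≠ 0)
    (h : ∀ p, (F * p + c * B * p ^ 2 / 2) ^ 2 = (1 + (B * p) ^ 2) * (G ^ 2 * (p - s) ^ 2)) :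
    B = 0 := by
  have hG : G * s = 0 := by
    have := h 0
    exact pow_eq_zero_iff two_ne_zero |>.1 (by linear_combination -this)
  by_contra hB
  rcases mul_eq_zero.1 hG with rfl | rfl
  · have h1 : F + c * B / 2 = 0 :=
      pow_eq_zero_iff two_ne_zero |>.1 (by linear_combination h 1)
    have h2 : -F + c * B / 2 = 0 :=
      pow_eq_zero_iff two_ne_zero |>.1 (by linear_combination h (-1))
    exact mul_ne_zero hc hB (by linear_combination h1 + h2)
  · have h1 := h 1
    have h2 := h (-1)
    have h3 := h 2
    have hF : F = 0 := by
      have : c * B * F = 0 := by linear_combination (1 / 2) * h1 - (1 / 2) * h2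
      simpa [hc, hB] using this
    subst hF
    have hG : G = 0 := pow_eq_zero_iff two_ne_zero |>.1 (by
      linear_combination (1 / 12) * h3 - (4 / 3) * h1)
    subst hG
    have : c * B = 0 := pow_eq_zero_iff two_ne_zero |>.1 (by linear_combination 4 * h1)
    exact mul_ne_zero hc hB this

theorem sq_eq_sq_of_sq_poly {B c F B' c' F' η t₀ : ℝ} (hc : 0 < c) (hc' : 0 < c')
    (hη : η ^ 2 = 1)
    (h : ∀ t, (1 + (B * t) ^ 2) * (F' * (η * t + t₀) + c' * B' * (η * t + t₀) ^ 2 / 2) ^ 2 =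
      (1 + (B' * (η * t + t₀)) ^ 2) * (F * t + c * B * t ^ 2 / 2) ^ 2) :
    B ^ 2 = B' ^ 2 ∧ B * t₀ = 0 := by
  have hcancel : ∀ p, η * (η * (p - t₀)) + t₀ = p := fun p => by
    linear_combination (p - t₀) * hη
  by_cases hB : B = 0
  · subst hB
    have : B' = 0 := by
      refine eq_zero_of_sq_poly (F := F') (G := F) (s := t₀) hc'.ne' fun p => ?_
      have := h (η * (p - t₀))
      rw [hcancel] at this
      linear_combination this + (1 + (B' * p) ^ 2) * F ^ 2 * (p - t₀) ^ 2 * hη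
    simp [this]
  by_cases hB' : B' = 0
  · subst hB'
    refine absurd ?_ hB
    refine eq_zero_of_sq_poly (F := F) (G := F') (s := -η * t₀) hc.ne' fun t => ?_
    linear_combination -h t - (1 + (B * t) ^ 2) * F' ^ 2 * (t₀ ^ 2 - t ^ 2) * hη
  have ht : t₀ = 0 := by
    by_contra ht
    have e1 : F' + c' * B' * t₀ / 2 = 0 := by
      apply mul_left_cancel₀ ht
      rw [mul_zero]
      exact pow_eq_zero_iff two_ne_zero |>.1 (by linear_combination h 0)
    have e2 : F = η * (c * B * t₀) / 2 := by
      have : -η * F + c * B * t₀ / 2 = 0 := by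
        apply mul_left_cancel₀ ht
        rw [mul_zero]
        refine pow_eq_zero_iff two_ne_zero |>.1 ?_
        have := h (η * (0 - t₀))
        rw [hcancel] at this
        linear_combination -this - (c ^ 2 * B ^ 2 * t₀ ^ 4 / 4 * (η ^ 2 + 1) -
          c * B * F * η * t₀ ^ 3) * hη
      linear_combination -η * this - F * hη
    have e3 : ∀ k : ℝ, k * (k + 1) ≠ 0 →
        (1 + B ^ 2 * t₀ ^ 2 * k ^ 2) * (c' * B') ^ 2 =
          (1 + B' ^ 2 * t₀ ^ 2 * (k + 1) ^ 2) * (c * B) ^ 2 := by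
      intro k hk
      have e4 : t₀ ^ 2 * (k * (k + 1)) ≠ 0 := mul_ne_zero (pow_ne_zero 2 ht) hk
      apply mul_left_cancel₀ (pow_ne_zero 2 e4)
      have := h (η * (t₀ * (k + 1) - t₀))
      rw [hcancel, e2, show F' = -(c' * B' * t₀ / 2) by linear_combination e1] at this
      have h4 : η ^ 4 = 1 := by linear_combination (η ^ 2 + 1) * hη
      ring_nf at this ⊢
      simp only [hη, h4] at this
      linear_combination 4 * this
    have k1 := e3 1 (by norm_num)
    have k2 := e3 2 (by norm_num)
    have k3 := e3 3 (by norm_num)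
    have : B' * t₀ * (c * B) = 0 := pow_eq_zero_iff two_ne_zero |>.1 (by
      linear_combination (3 / 4) * (k3 - 2 * k2 + k1) - (1 / 2) * (k2 - k1))
    exact mul_ne_zero (mul_ne_zero hB' ht) (mul_ne_zero hc.ne' hB) this
  refine ⟨?_, by simp [ht]⟩
  subst ht
  have e : ∀ t, t ≠ 0 → (1 + (B * t) ^ 2) * (F' * η + c' * B' * t / 2) ^ 2 =
      (1 + (B' * t) ^ 2) * (F + c * B * t / 2) ^ 2 := by
    intro t ht
    apply mul_left_cancel₀ (pow_ne_zero 2 ht)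
    have := h t
    have h3 : η ^ 3 = η := by linear_combination η * hη
    have h4 : η ^ 4 = 1 := by linear_combination (η ^ 2 + 1) * hη
    ring_nf at this ⊢
    simp only [hη, h3, h4] at this ⊢
    linear_combination this
  have a1 := e 1 (by norm_num)
  have a2 := e (-1) (by norm_num)
  have a3 := e 2 (by norm_num)
  have a4 := e (-2) (by norm_num)
  have a5 := e 3 (by norm_num)
  have a6 := e (-3) (by norm_num)
  ring_nf at a1 a2 a3 a4 a5 a6
  simp only [hη] at a1 a2 a3 a4 a5 a6
  have q4 : B ^ 2 * B' ^ 2 * c' ^ 2 = B ^ 2 * B' ^ 2 * c ^ 2 := by linarith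
  have q3 : B ^ 2 * (F' * η * c' * B') = B' ^ 2 * (F * c * B) := by linarith
  have q2 : c' ^ 2 * B' ^ 2 / 4 + B ^ 2 * F' ^ 2 = c ^ 2 * B ^ 2 / 4 + B' ^ 2 * F ^ 2 := by linarith
  have q1 : F' * η * c' * B' = F * c * B := by linarith
  have q0 : F' ^ 2 = F ^ 2 := by linarith
  have q4' : c' ^ 2 = c ^ 2 := by
    apply mul_left_cancel₀ (mul_ne_zero (pow_ne_zero 2 hB) (pow_ne_zero 2 hB'))
    exact q4
  by_contra hne
  have hF : F = 0 := by
    have : (B ^ 2 - B' ^ 2) * (F * c * B) = 0 := by linear_combination q3 - B ^ 2 * q1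
    simpa [sub_ne_zero.2 hne, hB, hc.ne'] using this
  have : (B ^ 2 - B' ^ 2) * c ^ 2 = 0 := by
    subst hF
    linear_combination -4 * q2 + 4 * B ^ 2 * q0 + B' ^ 2 * q4'
  simp [sub_ne_zero.2 hne, hc.ne'] at this

theorem params_eq_of_poly {B c d F B' c' d' F' ε η t₀ : ℝ} {φ : ℝ → ℝ} (hc : 0 < c)
    (hc' : 0 < c') (hd : 0 ≤ d) (hd' : 0 ≤ d')
    (hε : ε ^ 2 = 1) (hη : η ^ 2 = 1)
    (h : ∀ t z, (1 + (B * t) ^ 2) *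
      (d' * (ε * z + φ t) + F' * (η * t + t₀) + c' * B' * (η * t + t₀) ^ 2 / 2) ^ 2 =
      (1 + (B' * (η * t + t₀)) ^ 2) * (d * z + F * t + c * B * t ^ 2 / 2) ^ 2) :
    d = d' ∧ B ^ 2 = B' ^ 2 ∧ B * t₀ = 0 := by
  have hη0 : η ≠ 0 := by rintro rfl; norm_num at hη
  have hz : ∀ t, d' ^ 2 * (1 + (B * t) ^ 2) = d ^ 2 * (1 + (B' * (η * t + t₀)) ^ 2) := by
    intro t
    linear_combination (1 / 2) * h t 1 + (1 / 2) * h t (-1) - h t 0 -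
      d' ^ 2 * (1 + (B * t) ^ 2) * hε
  have z0 := hz 0
  have z1 := hz 1
  have z2 := hz (-1)
  by_cases hd0 : d = 0
  · subst hd0
    have : d' = 0 := by
      simp at z0
      exact z0
    subst this
    have hp : ∀ t, (1 + (B * t) ^ 2) * (F' * (η * t + t₀) + c' * B' * (η * t + t₀) ^ 2 / 2) ^ 2 =
      (1 + (B' * (η * t + t₀)) ^ 2) * (F * t + c * B * t ^ 2 / 2) ^ 2 := by
      intro t
      simpa using h t 0
    exact ⟨rfl, sq_eq_sq_of_sq_poly hc hc' hη hp⟩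
  · have hsq : (d' : ℝ) ^ 2 * B ^ 2 = d ^ 2 * B' ^ 2 := by
      linear_combination (1 / 2) * z1 + (1 / 2) * z2 - z0 + d ^ 2 * B' ^ 2 * hη
    have hlin : d ^ 2 * (B' ^ 2 * t₀) = 0 := by
      apply mul_left_cancel₀ hη0
      linear_combination (1 / 4) * z2 - (1 / 4) * z1
    have hlin' : B' ^ 2 * t₀ = 0 := by
      simpa [hd0] using hlin
    have hdd : d ^ 2 = d' ^ 2 := by
      linear_combination - z0 - d ^ 2 * t₀ * hlin'
    have hB : B ^ 2 = B' ^ 2 := by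
      apply mul_left_cancel₀ (pow_ne_zero 2 hd0)
      linear_combination hsq + B ^ 2 * hdd
    refine ⟨(pow_left_inj₀ hd hd' two_ne_zero).1 hdd, hB, ?_⟩
    rw [← hB] at hlin'
    simpa using hlin'

theorem tc_dr_one (f : Smooth3) (t z : ℝ) : tc 1 (dr f) t z = 2 * tc 2 f t z := by
  rw [tc_dr]; norm_num

theorem tc_dr_two (f : Smooth3) (t z : ℝ) : tc 2 (dr f) t z = 3 * tc 3 f t z := by
  rw [tc_dr]; norm_num

theorem tc_dr_three (f : Smooth3) (t z : ℝ) : tc 3 (dr f) t z = 4 * tc 4 f t z := by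
  rw [tc_dr]; norm_num

theorem tc_congr (n : ℕ) (t z : ℝ) {f g : Smooth3} (e : f = g) : tc n f t z = tc n g t z := by
  rw [e]

section

variable {B c d F B' c' d' F' : ℝ} {R T C : Smooth3}

theorem IsModelIsometry.zeroth_order (h : IsModelIsometry B c d F B' c' d' F' R T C) (t z : ℝ) :
    tc 1 T t z = 0 ∧ tc 0 (dz T) t z = 0 := by
  have h3 := tc_congr 0 t z h.TT
  simp only [tc_add, tc_zero_mul, tc_dr_zero, tc_zero_eq_zero h] at h3
  constructor <;> nlinarith [sq_nonneg (tc 1 T t z), sq_nonneg (tc 0 (dz T) t z),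
    sq_nonneg (tc 0 (W B c d F T) t z)]

theorem IsModelIsometry.first_order (h : IsModelIsometry B c d F B' c' d' F' R T C) (t z : ℝ) :
    tc 1 R t z ^ 2 * (1 + (B * t) ^ 2) = 1 + (B' * tc 0 T t z) ^ 2 ∧
    tc 0 (dt T) t z ^ 2 = 1 ∧
    2 * tc 2 T t z * (1 + (B * t) ^ 2) + tc 0 (dt T) t z * (B * t) = B' * tc 0 T t z ∧
    tc 0 (dz C) t z ^ 2 = 1 ∧
    d' * tc 0 C t z + F' * tc 0 T t z + c' * B' * tc 0 T t z ^ 2 / 2 =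
      tc 0 (dt T) t z * tc 1 R t z * tc 0 (dz C) t z *
        (d * z + F * t + c * B * t ^ 2 / 2) := by
  have hR := tc_zero_eq_zero h
  have hT := fun t z => (h.zeroth_order t z).1
  have hTz := fun t z => (h.zeroth_order t z).2
  have hRz := tc_dz_eq_zero (hR t) z
  have hT1z := tc_dz_eq_zero (hT t) z
  obtain ⟨o0, o1, o2⟩ := tc_om B' c' d' F' R T C t z (hR t z) (hT t z)
  have h1 := tc_congr 0 t z h.RR
  have h2 := tc_congr 1 t z h.RT
  have h3 := tc_congr 2 t z h.TT
  have h4 := tc_congr 0 t z h.RC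
  have h5 := tc_congr 1 t z h.TC
  have h6 := tc_congr 0 t z h.CC
  simp only [tc_add, tc_zero_mul, tc_one_mul, tc_two_mul, (tc_W B c d F _ t z).1,
    (tc_W B c d F _ t z).2.1, (tc_one t z).1, tc_smul, tc_dr_zero, tc_dr_one, o0, o1,
    hR, hT, hTz, hRz, hT1z] at h1 h2 h3 h4 h5 h6
  have h1' : tc 1 R t z ^ 2 + (B * t * tc 1 R t z) ^ 2 = 1 + (B' * tc 0 T t z) ^ 2 := by
    linear_combination h1
  refine ⟨by linear_combination h1', first_order_relations (C₁ := tc 1 C t z) h1' ?_ ?_ ?_ ?_ ?_⟩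
  · linear_combination h2
  · linear_combination h3
  · linear_combination h4
  · linear_combination h5
  · linear_combination h6

/-- The normal form of an isometry of model structures along the surface `r = 0`. -/
theorem IsModelIsometry.exists_normal_form (h : IsModelIsometry B c d F B' c' d' F' R T C)
    (hc : 0 < c) (hc' : 0 < c') (hd : 0 ≤ d) (hd' : 0 ≤ d') :
    ∃ η ε σ t₀ : ℝ, η ^ 2 = 1 ∧ ε ^ 2 = 1 ∧ σ ^ 2 = 1 ∧ d = d' ∧ B ^ 2 = B' ^ 2 ∧ B * t₀ = 0 ∧
      (∀ t z, tc 0 T t z = η * t + t₀) ∧ (∀ t z, tc 0 (dt T) t z = η) ∧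
      (∀ t z, tc 0 (dz C) t z = ε) ∧ (∀ t z, tc 0 C t z = ε * z + tc 0 C t 0) ∧
      ∀ t z, tc 1 R t z = σ := by
  have h1 := h.first_order
  obtain ⟨η, hη, hTt⟩ := exists_eq_of_sq_eq_one fun t z => (h1 t z).2.1
  obtain ⟨ε, hε, hCz⟩ := exists_eq_of_sq_eq_one fun t z => (h1 t z).2.2.2.1
  have hT : ∀ t z, tc 0 T t z = η * t + tc 0 T 0 0 := fun t z => by
    rw [tc_eq_linear_dz (fun z => (h.zeroth_order t z).2) z, tc_eq_linear_dt fun t => hTt t 0]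
    ring
  have hC : ∀ t z, tc 0 C t z = ε * z + tc 0 C t 0 := fun t z => tc_eq_linear_dz (hCz t) z
  obtain ⟨hdd, hBB, hBt⟩ := params_eq_of_poly (B := B) (B' := B')
    (c := c) (c' := c') (ε := ε) (η := η) (t₀ := tc 0 T 0 0) (φ := fun t => tc 0 C t 0)
    (F := F) (F' := F') hc hc' hd hd' hε hη fun t z => by
      obtain ⟨e1, -, -, -, e2⟩ := h1 t z
      rw [hC, hT, hTt, hCz] at e2
      rw [hT] at e1
      rw [e2]
      linear_combination (η ^ 2 * ε ^ 2 * (d * z + F * t + c * B * t ^ 2 / 2) ^ 2) * e1 +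
        (1 + (B' * (η * t + tc 0 T 0 0)) ^ 2) * (d * z + F * t + c * B * t ^ 2 / 2) ^ 2 *
          (ε ^ 2 * hη + hε)
  obtain ⟨σ, hσ, hR⟩ := exists_eq_of_sq_eq_one (n := 1) (f := R) fun t z => by
    have e1 := (h1 t z).1
    have hM : (1 + (B * t) ^ 2) ≠ 0 := by positivity
    rw [hT] at e1
    apply mul_left_cancel₀ hM
    linear_combination e1 - (η * t + tc 0 T 0 0) ^ 2 * hBB + B ^ 2 * t ^ 2 * hη +
      (2 * η * t + tc 0 T 0 0) * B * hBt
  exact ⟨η, ε, σ, tc 0 T 0 0, hη, hε, hσ, hdd, hBB, hBt, hT, hTt, hCz, hC, hR⟩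

theorem IsModelIsometry.shear_eq (h : IsModelIsometry B c d F B' c' d' F' R T C)
    (hc : 0 < c) (hc' : 0 < c') (hd : 0 ≤ d) (hd' : 0 ≤ d') : B = B' := by
  obtain ⟨η, ε, σ, t₀, hη, hε, hσ, rfl, hBB, hBt, hT, hTt, hCz, hC, hR1⟩ :=
    h.exists_normal_form hc hc' hd hd'
  by_cases hB : B = 0
  · subst hB
    simpa [eq_comm] using hBB
  obtain rfl : t₀ = 0 := by simpa [hB] using hBt
  have hσ0 : σ ≠ 0 := by rintro rfl; norm_num at hσ
  have hε0 : ε ≠ 0 := by rintro rfl; norm_num at hε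
  have hR := tc_zero_eq_zero h
  have hT1 := fun t z => (h.zeroth_order t z).1
  have hTz := fun t z => (h.zeroth_order t z).2
  have hRt := tc_dt_eq_zero hR
  have hRz := fun t => tc_dz_eq_zero (hR t)
  have hR1z := fun t => tc_dz_eq_zero (hR1 t)
  have hT1t := tc_dt_eq_zero hT1
  have hT1z := fun t => tc_dz_eq_zero (hT1 t)
  have hdσ : d * (σ - η) = 0 := by
    have e0 := (h.first_order 0 0).2.2.2.2
    have e1 := (h.first_order 0 1).2.2.2.2
    rw [hTt, hR1, hCz, hC, hT] at e0 e1
    have : ε * (d * (1 - η * σ)) = 0 := by linear_combination e1 - e0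
    have := (mul_eq_zero.1 this).resolve_left hε0
    linear_combination -η * this - d * σ * hη
  have hT2 : ∀ z, tc 2 T 0 z = 0 := fun z => by
    have := (h.first_order 0 z).2.2.1
    rw [hT] at this
    linear_combination this / 2
  have hT2t : ∀ z, 2 * tc 2 (dt T) 0 z = η * (B' - B) := fun z => by
    have h1 := ((hasDerivAt_tc_dt 2 T 0 z).const_mul 2).mul
      ((((hasDerivAt_id (0 : ℝ)).const_mul B).pow 2).const_add 1)
    have h2 : HasDerivAt (fun t => η * (B' - B) * t) (η * (B' - B) * 1) 0 :=
      (hasDerivAt_id (0 : ℝ)).const_mul _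
    have h3 : (fun t => 2 * tc 2 T t z) * (fun t : ℝ => 1 + ((fun y => B * id y) ^ 2) t) =
        fun t => η * (B' - B) * t := by
      funext t
      have := (h.first_order t z).2.2.1
      rw [hT, hTt] at this
      simp only [Pi.mul_apply, Pi.pow_apply, id]
      linear_combination this
    have := (h3 ▸ h1).unique h2
    simpa using this
  have hT2z := tc_dz_eq_zero hT2
  have hR2 : ∀ z, tc 2 R 0 z = 0 := fun z => by
    have := tc_congr 1 0 z h.RR
    simp only [tc_add, tc_one_mul, (tc_W B c d F _ 0 z).1, (tc_W B c d F _ 0 z).2.1,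
      (tc_one 0 z).2 0, tc_smul, tc_dr_zero, tc_dr_one, hR, hR1, hT, hT1, hRz, hR1z] at this
    apply mul_left_cancel₀ hσ0
    linear_combination this / 4
  have hT3 : ∀ z, tc 3 T 0 z = 0 := fun z => by
    have := tc_congr 2 0 z h.RT
    simp only [tc_add, tc_two_mul, (tc_W B c d F _ 0 z).1, (tc_W B c d F _ 0 z).2.1,
      tc_smul, tc_dr_zero, tc_dr_one, tc_dr_two, hR, hR1, hT, hT1, hRz, hR1z, hTz, hT1z, hR2,
      hTt, hRt, hT2] at this
    apply mul_left_cancel₀ hσ0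
    linear_combination (1 / 3) * this + (1 / 3) * σ * hdσ
  have hT3z := tc_dz_eq_zero hT3
  have hR3 : ∀ z, tc 3 R 0 z = 0 := fun z => by
    have := tc_congr 2 0 z h.RR
    simp only [tc_add, tc_two_mul, (tc_W B c d F _ 0 z).1, (tc_W B c d F _ 0 z).2.1,
      (tc_one 0 z).2 1, tc_smul, tc_dr_zero, tc_dr_one, tc_dr_two, hR, hR1, hT, hT1, hRz, hR1z,
      hRt, hR2] at this
    apply mul_left_cancel₀ hσ0
    linear_combination (1 / 6) * this
  have := tc_congr 4 0 0 h.TT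
  simp only [tc_add, tc_four_mul, (tc_W B c d F _ 0 0).1, (tc_W B c d F _ 0 0).2.1,
    (tc_W B c d F _ 0 0).2.2.1, (tc_W B c d F _ 0 0).2.2.2,
    tc_dr_zero, tc_dr_one, tc_dr_two, tc_dr_three, hR, hR1, hT1, hTz, hT1z, hT1t, hT2z, hT3z, hR2,
    hTt, hT2, hT3, hR3] at this
  linear_combination -this + η * hT2t 0 + (B' - B) * hη

theorem IsModelIsometry.params_eq (h : IsModelIsometry B c d F B' c' d' F' R T C)
    (hc : 0 < c) (hc' : 0 < c') (hd : 0 ≤ d) (hd' : 0 ≤ d') (hF : 0 ≤ F) (hF' : 0 ≤ F') :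
    B = B' ∧ c = c' ∧ d = d' ∧ F = F' := by
  obtain rfl := h.shear_eq hc hc' hd hd'
  obtain ⟨η, ε, σ, t₀, hη, hε, hσ, rfl, -, hBt, hT, hTt, hCz, hC, hR1⟩ :=
    h.exists_normal_form hc hc' hd hd'
  have hσ0 : σ ≠ 0 := by rintro rfl; norm_num at hσ
  have hε0 : ε ≠ 0 := by rintro rfl; norm_num at hε
  have hη0 : η ≠ 0 := by rintro rfl; norm_num at hη
  have hM : ∀ t : ℝ, 1 + (B * t) ^ 2 ≠ 0 := fun t => by positivity
  have hR := tc_zero_eq_zero h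
  have hT1 := fun t z => (h.zeroth_order t z).1
  have hTz := fun t z => (h.zeroth_order t z).2
  have hRt := tc_dt_eq_zero hR
  have hRz := fun t => tc_dz_eq_zero (hR t)
  have hR1z := fun t => tc_dz_eq_zero (hR1 t)
  have hT1t := tc_dt_eq_zero hT1
  have hT1z := fun t => tc_dz_eq_zero (hT1 t)
  have hΩ : ∀ t z, d * (ε * z + tc 0 C t 0) + F' * (η * t + t₀) +
      c' * B * (η * t + t₀) ^ 2 / 2 = η * σ * ε * (d * z + F * t + c * B * t ^ 2 / 2) := by
    intro t z
    have := (h.first_order t z).2.2.2.2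
    rwa [hTt, hR1, hCz, hC, hT] at this
  have hdσ : d * (σ - η) = 0 := by
    have : ε * (d * (1 - η * σ)) = 0 := by linear_combination hΩ 0 1 - hΩ 0 0
    have := (mul_eq_zero.1 this).resolve_left hε0
    linear_combination -η * this - d * σ * hη
  have hT2 : ∀ t z, tc 2 T t z = 0 := fun t z => by
    have := (h.first_order t z).2.2.1
    rw [hT, hTt] at this
    apply mul_left_cancel₀ (hM t)
    linear_combination this / 2 + hBt / 2
  have hT2t := tc_dt_eq_zero hT2
  have hT2z := fun t => tc_dz_eq_zero (hT2 t)
  have hR2 : ∀ t z, tc 2 R t z = 0 := fun t z => by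
    have := tc_congr 1 t z h.RR
    simp only [tc_add, tc_one_mul, (tc_W B c d F _ t z).1, (tc_W B c d F _ t z).2.1,
      (tc_one t z).2 0, tc_smul, tc_dr_zero, tc_dr_one, hR, hR1, hT, hT1, hRz, hR1z, hRt] at this
    apply mul_left_cancel₀ (mul_ne_zero hσ0 (hM t))
    linear_combination this / 4 - B * t * σ * hdσ / 2 + σ * d * hBt / 2
  have om0 : ∀ t z, tc 0 (om B c' d F' R T C) t z =
      η * σ * ε * (d * z + F * t + c * B * t ^ 2 / 2) := fun t z => by
    rw [(tc_om B c' d F' R T C t z (hR t z) (hT1 t z)).1, hC, hT, hΩ]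
  have hC1 : ∀ t z, tc 1 C t z = 0 := fun t z => by
    have := tc_congr 0 t z h.RC
    simp only [tc_add, tc_zero_mul, (tc_W B c d F _ t z).1, tc_smul, tc_dr_zero, hR, hR1, hT,
      hCz, hRz, om0] at this
    apply mul_left_cancel₀ (mul_ne_zero hσ0 (hM t))
    linear_combination this + (B * t * σ * ε * (d * z + F * t + c * B * t ^ 2 / 2)) * hη +
      η * σ * ε * (d * z + F * t + c * B * t ^ 2 / 2) * hBt
  have om1 : ∀ t z, tc 1 (om B c' d F' R T C) t z = 0 := fun t z => by
    rw [(tc_om B c' d F' R T C t z (hR t z) (hT1 t z)).2.1, hC1, mul_zero]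
  have hC1t := tc_dt_eq_zero hC1
  have hC1z := fun t => tc_dz_eq_zero (hC1 t)
  have hT3 : ∀ t z, tc 3 T t z = 0 := fun t z => by
    have := tc_congr 2 t z h.RT
    simp only [tc_add, tc_two_mul, (tc_W B c d F _ t z).1, (tc_W B c d F _ t z).2.1,
      (tc_W B c d F _ t z).2.2.1,
      tc_smul, tc_dr_zero, tc_dr_one, tc_dr_two, hR, hR1, hT, hT1, hRz, hR1z, hTz, hT1z, hR2,
      hTt, hRt, hT2, hT1t, hT2z] at this
    apply mul_left_cancel₀ (mul_ne_zero hσ0 (hM t))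
    linear_combination (1 / 3) * this + (1 / 3) * σ * hdσ
  have hT3z := fun t => tc_dz_eq_zero (hT3 t)
  have hC2t : ∀ t z, tc 2 C t z = 0 ∧ tc 0 (dt C) t z = 0 := fun t z => by
    have e1 := tc_congr 1 t z h.RC
    have e2 := tc_congr 2 t z h.TC
    simp only [tc_add, tc_one_mul, tc_two_mul, (tc_W B c d F _ t z).1, (tc_W B c d F _ t z).2.1,
      (tc_W B c d F _ t z).2.2.1, om0, om1,
      tc_smul, tc_dr_zero, tc_dr_one, tc_dr_two, hR, hR1, hT, hT1, hRz, hR1z, hTz, hT1z, hR2,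
      hTt, hRt, hT2, hT1t, hT2z, hC1, hC1z, hT3, hCz] at e1 e2
    have e3 : 2 * B * t * tc 2 C t z + tc 0 (dt C) t z = 0 := by
      apply mul_left_cancel₀ hη0
      linear_combination e2
    have e4 : tc 2 C t z = 0 := by
      apply mul_left_cancel₀ hσ0
      linear_combination e1 / 2 - B * t * σ * e3 / 2 +
        σ * η * ε * (d * z + F * t + c * B * t ^ 2 / 2) * hdσ / 2 +
        σ * ε * d * (d * z + F * t + c * B * t ^ 2 / 2) * hη / 2
    exact ⟨e4, by linear_combination e3 - 2 * B * t * e4⟩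
  have hC2 := fun t z => (hC2t t z).1
  have hC2z := fun t => tc_dz_eq_zero (hC2 t)
  have hφ : ∀ t, tc 0 C t 0 = tc 0 C 0 0 := fun t => by
    simpa using tc_eq_linear_dt (fun t => (hC2t t 0).2) t
  refine ⟨rfl, ?_, rfl, ?_⟩
  · have := tc_congr 3 0 0 h.TC
    simp only [tc_add, tc_three_mul, (tc_W B c d F _ 0 0).1, (tc_W B c d F _ 0 0).2.1,
      (tc_W B c d F _ 0 0).2.2.1, (tc_W B c d F _ 0 0).2.2.2, om0, om1,
      (tc_om B c' d F' R T C 0 0 (hR 0 0) (hT1 0 0)).2.2,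
      tc_dr_zero, tc_dr_one, tc_dr_two, tc_dr_three, hR, hR1, hT, hT1, hTz, hT1z,
      hTt, hT2, hT1t, hT2z, hC1, hC1z, hT3, hT3z, hCz, hC2, hC2z, hC1t, hT2t, hR2] at this
    have e : c' * σ = c * (η * ε) := by linear_combination -2 * this - c' * σ * hσ
    refine (pow_left_inj₀ hc.le hc'.le two_ne_zero).1 ?_
    linear_combination -(c' * σ + c * η * ε) * e + c' ^ 2 * hσ - c ^ 2 * (ε ^ 2 * hη + hε)
  · have e1 := hΩ 1 0
    have e2 := hΩ (-1) 0
    rw [hφ] at e1 e2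
    have e : F' = σ * ε * F := by
      apply mul_left_cancel₀ hη0
      linear_combination (e1 - e2) / 2 - c' * η * hBt
    refine (pow_left_inj₀ hF hF' two_ne_zero).1 ?_
    linear_combination -(F' + σ * ε * F) * e - F ^ 2 * (ε ^ 2 * hσ + hε)

end

end Smooth3

namespace HeisARS

theorem enorm_le (S : HeisARS) {p v : Heis} {x y w : ℝ}
    (h : x • S.lin p + y • S.V1 p + w • S.V2 p = v) :
    S.enorm p v ≤ ENNReal.ofReal (Real.sqrt (x ^ 2 + y ^ 2 + w ^ 2)) :=
  sInf_le ⟨x, y, w, h, rfl⟩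

theorem exists_of_enorm_lt (S : HeisARS) {p v : Heis} {r : ℝ}
    (h : S.enorm p v < ENNReal.ofReal r) : ∃ x y w : ℝ,
      x • S.lin p + y • S.V1 p + w • S.V2 p = v ∧ Real.sqrt (x ^ 2 + y ^ 2 + w ^ 2) < r := by
  obtain ⟨_, ⟨x, y, w, hv, rfl⟩, hlt⟩ := sInf_lt_iff.1 h
  exact ⟨x, y, w, hv, ((ENNReal.ofReal_lt_ofReal_iff_of_nonneg (Real.sqrt_nonneg _)).1 hlt)⟩

theorem cometric_le {S S' : HeisARS} {p q : Heis} {A : Heis →L[ℝ] Heis}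
    (hA : ∀ v, S'.enorm q (A v) ≤ S.enorm p v) (ξ : Heis →L[ℝ] ℝ) :
    ξ (A (S.lin p)) ^ 2 + ξ (A (S.V1 p)) ^ 2 + ξ (A (S.V2 p)) ^ 2 ≤
      ξ (S'.lin q) ^ 2 + ξ (S'.V1 q) ^ 2 + ξ (S'.V2 q) ^ 2 := by
  set a := ξ (A (S.lin p)) with ha
  set b := ξ (A (S.V1 p)) with hb
  set c := ξ (A (S.V2 p)) with hc
  set a' := ξ (S'.lin q) with ha'
  set b' := ξ (S'.V1 q) with hb'
  set c' := ξ (S'.V2 q) with hc'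
  set s := Real.sqrt (a ^ 2 + b ^ 2 + c ^ 2) with hs
  set s' := Real.sqrt (a' ^ 2 + b' ^ 2 + c' ^ 2) with hs'
  have hs0 : 0 ≤ s := Real.sqrt_nonneg _
  have hs0' : 0 ≤ s' := Real.sqrt_nonneg _
  have hsq : s ^ 2 = a ^ 2 + b ^ 2 + c ^ 2 := Real.sq_sqrt (by positivity)
  have hsq' : s' ^ 2 = a' ^ 2 + b' ^ 2 + c' ^ 2 := Real.sq_sqrt (by positivity)
  have key : ∀ δ > 0, s ^ 2 ≤ s * s' + δ * s' := by
    intro δ hδ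
    obtain ⟨x, y, w, hv, hlt⟩ := S'.exists_of_enorm_lt
      (((hA _).trans (S.enorm_le (x := a) (y := b) (w := c) rfl)).trans_lt
        ((ENNReal.ofReal_lt_ofReal_iff (by positivity)).2 (lt_add_of_pos_right s hδ)))
    have h1 : s ^ 2 = x * a' + y * b' + w * c' := by
      have := congrArg ξ hv
      simp only [map_add, map_smul, smul_eq_mul, ← ha, ← hb, ← hc, ← ha', ← hb', ← hc'] at this
      rw [hsq]
      linear_combination -this
    have h2 : x * a' + y * b' + w * c' ≤ Real.sqrt (x ^ 2 + y ^ 2 + w ^ 2) * s' := by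
      rw [hs', ← Real.sqrt_mul (by positivity)]
      refine Real.le_sqrt_of_sq_le ?_
      nlinarith [sq_nonneg (x * b' - y * a'), sq_nonneg (x * c' - w * a'),
        sq_nonneg (y * c' - w * b')]
    nlinarith
  have h0 : s ^ 2 ≤ s * s' := by
    refine le_of_forall_pos_le_add fun e he => ?_
    have h1 := key (e / (s' + 1)) (by positivity)
    have h2 : e / (s' + 1) * s' ≤ e := by
      rw [div_mul_eq_mul_div, div_le_iff₀ (by positivity)]
      nlinarith
    linarith
  rw [← hsq, ← hsq']
  nlinarith [sq_nonneg (s - s')]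

end HeisARS

theorem IsHeisDiffeo.exists_fderiv_inv {Φ : Heis → Heis} (h : IsHeisDiffeo Φ) :
    ∃ Ψ : Heis → Heis, IsHeisDiffeo Ψ ∧ Function.LeftInverse Ψ Φ ∧ Function.RightInverse Ψ Φ ∧
      (∀ p v, fderiv ℝ Ψ (Φ p) (fderiv ℝ Φ p v) = v) ∧
      ∀ p v, fderiv ℝ Φ p (fderiv ℝ Ψ (Φ p) v) = v := by
  obtain ⟨-, hΦ, Ψ, hl, hr, hΨ⟩ := h
  refine ⟨Ψ, ⟨⟨hr.injective, hl.surjective⟩, hΨ, Φ, hr, hl, hΦ⟩, hl, hr, ?_, ?_⟩ <;> intro p v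
  all_goals
    have dΦ := ((hΦ.differentiable (by simp)) p).hasFDerivAt
    have dΨ := ((hΨ.differentiable (by simp)) (Φ p)).hasFDerivAt
  · have h1 := dΨ.comp p dΦ
    rw [hl.comp_eq_id] at h1
    exact DFunLike.congr_fun (h1.unique (hasFDerivAt_id p)) v
  · have h1 : HasFDerivAt (Φ ∘ Ψ) (fderiv ℝ Φ p ∘L fderiv ℝ Ψ (Φ p)) (Φ p) :=
      HasFDerivAt.comp (Φ p) (by rwa [hl p]) dΨ
    rw [hr.comp_eq_id] at h1
    exact DFunLike.congr_fun (h1.unique (hasFDerivAt_id (Φ p))) v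

theorem IsHeisIsometry.cometric_eq {S S' : HeisARS} {Φ : Heis → Heis}
    (h : IsHeisIsometry S S' Φ) (p : Heis) (ξ ζ : Heis →L[ℝ] ℝ) :
    ξ (fderiv ℝ Φ p (S.lin p)) * ζ (fderiv ℝ Φ p (S.lin p)) +
        ξ (fderiv ℝ Φ p (S.V1 p)) * ζ (fderiv ℝ Φ p (S.V1 p)) +
        ξ (fderiv ℝ Φ p (S.V2 p)) * ζ (fderiv ℝ Φ p (S.V2 p)) =
      ξ (S'.lin (Φ p)) * ζ (S'.lin (Φ p)) + ξ (S'.V1 (Φ p)) * ζ (S'.V1 (Φ p)) +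
        ξ (S'.V2 (Φ p)) * ζ (S'.V2 (Φ p)) := by
  obtain ⟨hΦ, hn⟩ := h
  obtain ⟨Ψ, -, -, -, -, hinv⟩ := hΦ.exists_fderiv_inv
  have hsq : ∀ ξ : Heis →L[ℝ] ℝ,
      ξ (fderiv ℝ Φ p (S.lin p)) ^ 2 + ξ (fderiv ℝ Φ p (S.V1 p)) ^ 2 +
        ξ (fderiv ℝ Φ p (S.V2 p)) ^ 2 =
      ξ (S'.lin (Φ p)) ^ 2 + ξ (S'.V1 (Φ p)) ^ 2 + ξ (S'.V2 (Φ p)) ^ 2 := by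
    intro ξ
    refine le_antisymm (HeisARS.cometric_le (fun v => (hn p v).le) ξ) ?_
    have := HeisARS.cometric_le (S := S') (S' := S) (p := Φ p) (q := p) (A := fderiv ℝ Ψ (Φ p))
      (fun v => by rw [← hn, hinv]) (ξ ∘L fderiv ℝ Φ p)
    simpa only [ContinuousLinearMap.comp_apply, hinv] using this
  have h1 := hsq (ξ + ζ)
  simp only [add_apply] at h1
  linear_combination (h1 - hsq ξ - hsq ζ) / 2

/-- Coordinates on the Heisenberg group straightening a normalized structure. -/
def modelChart (c d : ℝ) (q : Heis) : Heis :=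
  (q.1 - d * q.2.1, c * q.2.1, q.2.2 - c * d / 2 * q.2.1 ^ 2)

theorem contDiff_modelChart (c d : ℝ) : ContDiff ℝ (⊤ : ℕ∞) (modelChart c d) := by
  unfold modelChart
  fun_prop

theorem fderiv_modelChart (c d : ℝ) (q v : Heis) : fderiv ℝ (modelChart c d) q v =
    (v.1 - d * v.2.1, c * v.2.1, v.2.2 - c * d * q.2.1 * v.2.1) := by
  have h1 : HasFDerivAt (fun q : Heis => q.1) (ContinuousLinearMap.fst ℝ ℝ (ℝ × ℝ)) q :=
    hasFDerivAt_fst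
  have h2 : HasFDerivAt (fun q : Heis => q.2.1)
      (ContinuousLinearMap.fst ℝ ℝ ℝ ∘L ContinuousLinearMap.snd ℝ ℝ (ℝ × ℝ)) q :=
    hasFDerivAt_snd.fst
  have h3 : HasFDerivAt (fun q : Heis => q.2.2)
      (ContinuousLinearMap.snd ℝ ℝ ℝ ∘L ContinuousLinearMap.snd ℝ ℝ (ℝ × ℝ)) q :=
    hasFDerivAt_snd.snd
  have h : HasFDerivAt (modelChart c d) _ q :=
    (h1.sub (h2.const_mul d)).prodMk
      ((h2.const_mul c).prodMk (h3.sub ((h2.pow 2).const_mul (c * d / 2))))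
  rw [h.fderiv]
  ext <;> simp
  ring

open Smooth3

theorem Smooth3.W_apply (B c d F : ℝ) (f : Smooth3) (q : Heis) :
    (W B c d F f).1 q = (pd (B * q.2.1 + d * q.1, q.1,
      d * q.2.2 + F * q.2.1 + c / 2 * (q.1 ^ 2 + B * q.2.1 ^ 2)) f).1 q := by
  have h : ∀ x y z : ℝ, (pd (x, y, z) f).1 q =
      x * (dr f).1 q + y * (dt f).1 q + z * (dz f).1 q := by
    intro x y z
    simp only [pd_apply]
    rw [show ((x, y, z) : Heis) = x • (1, 0, 0) + y • (0, 1, 0) + z • (0, 0, 1) by simp]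
    simp only [map_add, map_smul, smul_eq_mul]
  rw [h]
  simp only [W, om, val_add, val_mul, val_smul]
  simp only [cr, ct, cz]
  ring

theorem subalgNormal_V1 (b c d f : ℝ) (p : Heis) : (subalgNormal b c d f).V1 p = (1, 0, 0) := by
  simp [HeisARS.V1, heisLI, subalgNormal, XLv, heisX]

theorem subalgNormal_V2 (b c d f : ℝ) (p : Heis) : (subalgNormal b c d f).V2 p = (0, 0, 1) := by
  simp [HeisARS.V2, heisLI, subalgNormal, ZLv, heisZ]

theorem subalgNormal_lin (b c d f : ℝ) (p : Heis) : (subalgNormal b c d f).lin p =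
    (b * p.2.1, c * p.1 + d * p.2.1,
      f * p.2.1 + d * p.2.2 + c * p.1 ^ 2 / 2 + b * p.2.1 ^ 2 / 2) := by
  simp [HeisARS.lin, subalgNormal]

theorem IsHeisIsometry.exists_isModelIsometry {b c d f b' c' d' f' : ℝ} {Φ : Heis → Heis}
    (h : IsHeisIsometry (subalgNormal b c d f) (subalgNormal b' c' d' f') Φ) (hc' : c' ≠ 0) :
    ∃ R T C, IsModelIsometry (b * c) c d (f * c) (b' * c') c' d' (f' * c') R T C := by
  have hΦ : ContDiff ℝ (⊤ : ℕ∞) Φ := h.1.smooth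
  have hκ := contDiff_modelChart c d
  have hcomp : ContDiff ℝ (⊤ : ℕ∞) (Φ ∘ modelChart c d) := hΦ.comp hκ
  have s1 : ContDiff ℝ (⊤ : ℕ∞) fun q => (Φ (modelChart c d q)).1 := contDiff_fst.comp hcomp
  have s2 : ContDiff ℝ (⊤ : ℕ∞) fun q => (Φ (modelChart c d q)).2.1 :=
    contDiff_fst.comp (contDiff_snd.comp hcomp)
  have s3 : ContDiff ℝ (⊤ : ℕ∞) fun q => (Φ (modelChart c d q)).2.2 :=
    contDiff_snd.comp (contDiff_snd.comp hcomp)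
  let R : Smooth3 := ⟨fun q => (Φ (modelChart c d q)).1 + d' / c' * (Φ (modelChart c d q)).2.1,
    s1.add (contDiff_const.mul s2)⟩
  let T : Smooth3 := ⟨fun q => c'⁻¹ * (Φ (modelChart c d q)).2.1, contDiff_const.mul s2⟩
  let C : Smooth3 := ⟨fun q => (Φ (modelChart c d q)).2.2 +
    d' / (2 * c') * (Φ (modelChart c d q)).2.1 ^ 2, s3.add (contDiff_const.mul (s2.pow 2))⟩
  let l1 : Heis →L[ℝ] ℝ := ContinuousLinearMap.fst ℝ ℝ (ℝ × ℝ)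
  let l2 : Heis →L[ℝ] ℝ := ContinuousLinearMap.fst ℝ ℝ ℝ ∘L ContinuousLinearMap.snd ℝ ℝ (ℝ × ℝ)
  let l3 : Heis →L[ℝ] ℝ := ContinuousLinearMap.snd ℝ ℝ ℝ ∘L ContinuousLinearMap.snd ℝ ℝ (ℝ × ℝ)
  let ξR : Heis →L[ℝ] ℝ := l1 + (d' / c') • l2
  let ξT : Heis →L[ℝ] ℝ := c'⁻¹ • l2
  let ξC : Heis → Heis →L[ℝ] ℝ := fun q =>
    l3 + (d' / c' * (Φ (modelChart c d q)).2.1) • l2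
  have hd : ∀ q, HasFDerivAt (Φ ∘ modelChart c d)
      (fderiv ℝ Φ (modelChart c d q) ∘L fderiv ℝ (modelChart c d) q) q := fun q =>
    ((hΦ.differentiable (by simp)) _).hasFDerivAt.comp q
      ((hκ.differentiable (by simp)) _).hasFDerivAt
  have d2 : ∀ q, HasFDerivAt (fun q => (Φ (modelChart c d q)).2.1)
      (l2 ∘L (fderiv ℝ Φ (modelChart c d q) ∘L fderiv ℝ (modelChart c d) q)) q := fun q =>
    (hd q).snd.fst
  have d1 : ∀ q, HasFDerivAt (fun q => (Φ (modelChart c d q)).1)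
      (l1 ∘L (fderiv ℝ Φ (modelChart c d q) ∘L fderiv ℝ (modelChart c d) q)) q := fun q =>
    (hd q).fst
  have d3 : ∀ q, HasFDerivAt (fun q => (Φ (modelChart c d q)).2.2)
      (l3 ∘L (fderiv ℝ Φ (modelChart c d q) ∘L fderiv ℝ (modelChart c d) q)) q := fun q =>
    (hd q).snd.snd
  have hR : ∀ v q, (pd v R).1 q =
      ξR (fderiv ℝ Φ (modelChart c d q) (fderiv ℝ (modelChart c d) q v)) := fun v q => by
    have : HasFDerivAt R.1 _ q := (d1 q).add ((d2 q).const_mul (d' / c'))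
    rw [pd_apply, this.fderiv]; rfl
  have hT : ∀ v q, (pd v T).1 q =
      ξT (fderiv ℝ Φ (modelChart c d q) (fderiv ℝ (modelChart c d) q v)) := fun v q => by
    rw [pd_apply, ((d2 q).const_mul c'⁻¹).fderiv]; rfl
  have hC : ∀ v q, (pd v C).1 q =
      ξC q (fderiv ℝ Φ (modelChart c d q) (fderiv ℝ (modelChart c d) q v)) := fun v q => by
    have : HasFDerivAt C.1 _ q := (d3 q).add (((d2 q).pow 2).const_mul (d' / (2 * c')))
    rw [pd_apply, this.fderiv]
    simp [ξC]
    field_simp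
  have f1 : ∀ q, fderiv ℝ (modelChart c d) q (1, 0, 0) =
      (subalgNormal b c d f).V1 (modelChart c d q) := fun q => by
    rw [fderiv_modelChart, subalgNormal_V1]; simp
  have f2 : ∀ q, fderiv ℝ (modelChart c d) q (0, 0, 1) =
      (subalgNormal b c d f).V2 (modelChart c d q) := fun q => by
    rw [fderiv_modelChart, subalgNormal_V2]; simp
  have f0 : ∀ q : Heis, fderiv ℝ (modelChart c d) q (b * c * q.2.1 + d * q.1, q.1,
      d * q.2.2 + f * c * q.2.1 + c / 2 * (q.1 ^ 2 + b * c * q.2.1 ^ 2)) =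
      (subalgNormal b c d f).lin (modelChart c d q) := fun q => by
    rw [fderiv_modelChart, subalgNormal_lin]
    ext <;> simp [modelChart] <;> ring
  have g0R : ∀ q, ξR ((subalgNormal b' c' d' f').lin (Φ (modelChart c d q))) =
      ((b' * c') • T + d' • R).1 q := fun q => by
    rw [subalgNormal_lin]
    simp only [val_add, val_smul]
    simp [ξR, l1, l2, R, T]
    field_simp
  have g0T : ∀ q, ξT ((subalgNormal b' c' d' f').lin (Φ (modelChart c d q))) = R.1 q := fun q => by
    rw [subalgNormal_lin]
    simp [ξT, l2, R]
    field_simp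
  have g0C : ∀ q, ξC q ((subalgNormal b' c' d' f').lin (Φ (modelChart c d q))) =
      (om (b' * c') c' d' (f' * c') R T C).1 q := fun q => by
    rw [subalgNormal_lin]
    simp only [om, val_add, val_smul, val_mul]
    simp [ξC, l2, l3, R, T, C]
    field_simp
    ring
  have key : ∀ q ξ ζ, _ := fun q ξ ζ => h.cometric_eq (modelChart c d q) ξ ζ
  simp only [subalgNormal_V1 b' c' d' f', subalgNormal_V2 b' c' d' f', ← f0, ← f1, ← f2] at key
  have hRX : ξR (1, 0, 0) = 1 := by simp [ξR, l1, l2]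
  have hRZ : ξR (0, 0, 1) = 0 := by simp [ξR, l1, l2]
  have hTX : ξT (1, 0, 0) = 0 := by simp [ξT, l2]
  have hTZ : ξT (0, 0, 1) = 0 := by simp [ξT, l2]
  have hCX : ∀ q, ξC q (1, 0, 0) = 0 := fun q => by simp [ξC, l2, l3]
  have hCZ : ∀ q, ξC q (0, 0, 1) = 1 := fun q => by simp [ξC, l2, l3]
  refine ⟨R, T, C, ?_, ?_, ?_, ?_, ?_, ?_⟩ <;> ext q <;>
    simp only [val_add, val_mul, W_apply, val_one, ← g0T, ← g0C] <;>
    simp only [hR, hT, hC, ← val_add, ← g0R]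
  · have := key q ξR ξR
    simp only [hRX, hRZ] at this
    linear_combination this
  · have := key q ξR ξT
    simp only [hRX, hRZ, hTX, hTZ] at this
    linear_combination this
  · have := key q ξT ξT
    simp only [hTX, hTZ] at this
    linear_combination this
  · have := key q ξR (ξC q)
    simp only [hRX, hRZ, hCX, hCZ] at this
    linear_combination this
  · have := key q ξT (ξC q)
    simp only [hTX, hTZ, hCX, hCZ] at this
    linear_combination this
  · have := key q (ξC q) (ξC q)
    simp only [hCX, hCZ] at this
    linear_combination this

theorem subalgNormal_params_eq {b c d f b' c' d' f' : ℝ} (hc : 0 < c) (hd : 0 ≤ d) (hf : 0 ≤ f)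
    (hc' : 0 < c') (hd' : 0 ≤ d') (hf' : 0 ≤ f')
    (h : HeisIsometric (subalgNormal b c d f) (subalgNormal b' c' d' f')) :
    b = b' ∧ c = c' ∧ d = d' ∧ f = f' := by
  obtain ⟨Φ, hΦ⟩ := h
  obtain ⟨R, T, C, hm⟩ := hΦ.exists_isModelIsometry hc'.ne'
  obtain ⟨hB, rfl, rfl, hF⟩ := hm.params_eq hc hc' hd hd' (by positivity) (by positivity)
  exact ⟨mul_right_cancel₀ hc.ne' hB, rfl, rfl, mul_right_cancel₀ hc.ne' hF⟩

theorem HeisIsometric.symm {S S' : HeisARS} (h : HeisIsometric S S') : HeisIsometric S' S := by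
  obtain ⟨Φ, hd, hn⟩ := h
  obtain ⟨Ψ, hΨ, hl, hr, -, hinv⟩ := hd.exists_fderiv_inv
  refine ⟨Ψ, hΨ, fun q v => ?_⟩
  obtain ⟨p, rfl⟩ := hd.bijective.surjective q
  rw [hl p, ← hn, hinv]

theorem isHeisIsometry_of_frame {S S' : HeisARS} {Φ : Heis → Heis} (hΦ : IsHeisDiffeo Φ)
    {ε τ x y : ℝ} (hε : ε ^ 2 = 1) (hτ : τ ^ 2 = 1) (hxy : x ^ 2 + y ^ 2 = 1)
    (h0 : ∀ p, fderiv ℝ Φ p (S.lin p) = ε • S'.lin (Φ p))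
    (h1 : ∀ p, fderiv ℝ Φ p (S.V1 p) = x • S'.V1 (Φ p) + y • S'.V2 (Φ p))
    (h2 : ∀ p, fderiv ℝ Φ p (S.V2 p) = τ • (-y • S'.V1 (Φ p) + x • S'.V2 (Φ p))) :
    IsHeisIsometry S S' Φ := by
  obtain ⟨Ψ, -, -, -, hinv, -⟩ := hΦ.exists_fderiv_inv
  refine ⟨hΦ, fun p v => congrArg sInf (Set.ext fun r => ⟨?_, ?_⟩)⟩
  · rintro ⟨a, b, c, hv, rfl⟩
    refine ⟨ε * a, x * b + y * c, τ * (-y * b + x * c), ?_, ?_⟩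
    · rw [← hinv p v, ← hinv p (_ + _ + _), ← hv]
      congr 1
      simp only [map_add, map_smul, h0, h1, h2]
      match_scalars
      · linear_combination a * hε
      · linear_combination b * hxy + (y * (y * b - x * c)) * hτ
      · linear_combination c * hxy + (x * (x * c - y * b)) * hτ
    · congr 2
      linear_combination -a ^ 2 * hε - (b ^ 2 + c ^ 2) * hxy - (x * c - y * b) ^ 2 * hτ
  · rintro ⟨a, b, c, hv, rfl⟩
    refine ⟨ε * a, x * b - τ * y * c, y * b + τ * x * c, ?_, ?_⟩
    · rw [← hv]
      simp only [map_add, map_smul, h0, h1, h2]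
      module
    · congr 2
      linear_combination -a ^ 2 * hε - (b ^ 2 + τ ^ 2 * c ^ 2) * hxy - c ^ 2 * hτ

/-- The automorphism of the Heisenberg group whose differential at the identity maps
`X` to `(p, r, m)` and `Y` to `(q, s, n)`. -/
def heisAut (p q r s m n : ℝ) (v : Heis) : Heis :=
  (p * v.1 + q * v.2.1, r * v.1 + s * v.2.1,
   m * v.1 + n * v.2.1 + (p * s - q * r) * v.2.2 + p * r / 2 * v.1 ^ 2 +
    q * r * (v.1 * v.2.1) + q * s / 2 * v.2.1 ^ 2)

theorem contDiff_heisAut (p q r s m n : ℝ) : ContDiff ℝ (⊤ : ℕ∞) (heisAut p q r s m n) := by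
  unfold heisAut
  fun_prop

theorem fderiv_heisAut (p q r s m n : ℝ) (u v : Heis) : fderiv ℝ (heisAut p q r s m n) u v =
    (p * v.1 + q * v.2.1, r * v.1 + s * v.2.1,
     (m + p * r * u.1 + q * r * u.2.1) * v.1 + (n + q * r * u.1 + q * s * u.2.1) * v.2.1 +
      (p * s - q * r) * v.2.2) := by
  have h1 : HasFDerivAt (fun q : Heis => q.1) (ContinuousLinearMap.fst ℝ ℝ (ℝ × ℝ)) u :=
    hasFDerivAt_fst
  have h2 : HasFDerivAt (fun q : Heis => q.2.1)
      (ContinuousLinearMap.fst ℝ ℝ ℝ ∘L ContinuousLinearMap.snd ℝ ℝ (ℝ × ℝ)) u :=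
    hasFDerivAt_snd.fst
  have h3 : HasFDerivAt (fun q : Heis => q.2.2)
      (ContinuousLinearMap.snd ℝ ℝ ℝ ∘L ContinuousLinearMap.snd ℝ ℝ (ℝ × ℝ)) u :=
    hasFDerivAt_snd.snd
  have h : HasFDerivAt (heisAut p q r s m n) _ u :=
    ((h1.const_mul p).add (h2.const_mul q)).prodMk
      (((h1.const_mul r).add (h2.const_mul s)).prodMk
        ((((((h1.const_mul m).add (h2.const_mul n)).add (h3.const_mul (p * s - q * r))).add
          ((h1.pow 2).const_mul (p * r / 2))).add ((h1.mul h2).const_mul (q * r))).add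
            ((h2.pow 2).const_mul (q * s / 2))))
  rw [h.fderiv]
  ext <;> simp
  ring

theorem isHeisDiffeo_heisAut {p q r s : ℝ} (m n : ℝ) (h : p * s - q * r ≠ 0) :
    IsHeisDiffeo (heisAut p q r s m n) := by
  set l := p * s - q * r with hl
  let Ψ : Heis → Heis := fun v =>
    (l⁻¹ * (s * v.1 - q * v.2.1), l⁻¹ * (p * v.2.1 - r * v.1),
      l⁻¹ * (v.2.2 - (m * (l⁻¹ * (s * v.1 - q * v.2.1)) + n * (l⁻¹ * (p * v.2.1 - r * v.1)) +
        p * r / 2 * (l⁻¹ * (s * v.1 - q * v.2.1)) ^ 2 +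
        q * r * ((l⁻¹ * (s * v.1 - q * v.2.1)) * (l⁻¹ * (p * v.2.1 - r * v.1))) +
        q * s / 2 * (l⁻¹ * (p * v.2.1 - r * v.1)) ^ 2)))
  have e : l * l⁻¹ = 1 := mul_inv_cancel₀ h
  have hL : Function.LeftInverse Ψ (heisAut p q r s m n) := by
    rintro ⟨x, y, z⟩
    have e1 : l⁻¹ * (s * (p * x + q * y) - q * (r * x + s * y)) = x := by
      linear_combination x * e - l⁻¹ * x * hl
    have e2 : l⁻¹ * (p * (r * x + s * y) - r * (p * x + q * y)) = y := by
      linear_combination y * e - l⁻¹ * y * hl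
    simp only [Ψ, heisAut, e1, e2, Prod.mk.injEq, true_and]
    linear_combination z * e - l⁻¹ * z * hl
  have hR : Function.RightInverse Ψ (heisAut p q r s m n) := by
    rintro ⟨x, y, z⟩
    simp only [Ψ, heisAut]
    ext
    · simp only
      linear_combination x * e - l⁻¹ * x * hl
    · simp only
      linear_combination y * e - l⁻¹ * y * hl
    · simp only [← hl]
      linear_combination (z - (m * (l⁻¹ * (s * x - q * y)) + n * (l⁻¹ * (p * y - r * x)) +
        p * r / 2 * (l⁻¹ * (s * x - q * y)) ^ 2 +
        q * r * ((l⁻¹ * (s * x - q * y)) * (l⁻¹ * (p * y - r * x))) +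
        q * s / 2 * (l⁻¹ * (p * y - r * x)) ^ 2)) * e
  refine ⟨⟨hL.injective, hR.surjective⟩, contDiff_heisAut p q r s m n, Ψ, hL, hR, ?_⟩
  simp only [Ψ]
  fun_prop

theorem fderiv_heisAut_lin {S : HeisARS} {b c d f ε p q r s m n : ℝ}
    (h1 : ε * (S.a * p + S.b * r) = c * q) (h2 : ε * (S.c * p + S.d * r) = c * s)
    (h3 : ε * (S.e * p + S.f * r + (S.a + S.d) * m) = c * n)
    (k1 : ε * (S.a * q + S.b * s) = b * p + d * q)
    (k2 : ε * (S.c * q + S.d * s) = b * r + d * s)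
    (k3 : ε * (S.e * q + S.f * s + (S.a + S.d) * n) = b * m + d * n + f * (p * s - q * r))
    (hd : ε * (S.a + S.d) = d) (v : Heis) :
    fderiv ℝ (heisAut p q r s m n) v ((subalgNormal b c d f).lin v) =
      ε • S.lin (heisAut p q r s m n v) := by
  obtain ⟨x, y, z⟩ := v
  rw [fderiv_heisAut, subalgNormal_lin]
  simp only [HeisARS.lin, heisAut, Prod.smul_mk, smul_eq_mul, Prod.mk.injEq]
  refine ⟨?_, ?_, ?_⟩
  · linear_combination -x * h1 - y * k1
  · linear_combination -x * h2 - y * k2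
  · linear_combination -x * h3 - y * k3 - x ^ 2 / 2 * (p * h2 + r * h1) -
      y ^ 2 / 2 * (s * k1 + q * k2) - x * y * (r * k1 + q * h2) - (p * s - q * r) * z * hd

theorem HeisLieGen.tangent {F : Set (Heis → Heis)} {L : Heis →L[ℝ] ℝ}
    (hF : ∀ V ∈ F, ∀ p, L p = 0 → L (V p) = 0) {V : Heis → Heis} (hV : HeisLieGen F V) :
    ∀ p, L p = 0 → L (V p) = 0 := by
  have key : ∀ W : Heis → Heis, (∀ p, L p = 0 → L (W p) = 0) →
      ∀ p v, L p = 0 → L v = 0 → L (fderiv ℝ W p v) = 0 := by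
    intro W hW p v hp hv
    by_cases hd : DifferentiableAt ℝ W p
    · have h1 : HasDerivAt (fun s : ℝ => p + s • v) v 0 := by
        simpa using ((hasDerivAt_id (0 : ℝ)).smul_const v).const_add p
      have hd' : HasFDerivAt W (fderiv ℝ W p) (p + (0 : ℝ) • v) := by
        simpa using hd.hasFDerivAt
      have h2 : HasDerivAt (fun s : ℝ => L (W (p + s • v))) (L (fderiv ℝ W p v)) 0 :=
        L.hasFDerivAt.comp_hasDerivAt 0 (hd'.comp_hasDerivAt 0 h1)
      have h3 : (fun s : ℝ => L (W (p + s • v))) = fun _ => 0 :=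
        funext fun s => hW _ (by simp [hp, hv])
      rw [h3] at h2
      exact h2.unique (hasDerivAt_const 0 0)
    · simp [fderiv_zero_of_not_differentiableAt hd]
  induction hV with
  | base h => exact hF _ h
  | add _ _ h1 h2 =>
    intro p hp
    simp [h1 p hp, h2 p hp]
  | smul c _ h =>
    intro p hp
    simp [h p hp]
  | bracket _ _ h1 h2 =>
    intro p hp
    simp [vfBracketH, key _ h2 p _ hp (h1 p hp), key _ h1 p _ hp (h2 p hp)]

namespace HeisARS

theorem V1_eq (S : HeisARS) (p : Heis) :
    S.V1 p = (S.B1.1, S.B1.2.1, S.B1.2.2 + p.1 * S.B1.2.1) := by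
  simp [V1, heisLI, heisX, heisY, heisZ]
  ring

theorem V2_eq (S : HeisARS) (p : Heis) :
    S.V2 p = (S.B2.1, S.B2.2.1, S.B2.2.2 + p.1 * S.B2.2.1) := by
  simp [V2, heisLI, heisX, heisY, heisZ]
  ring

theorem IsARS.independent {S : HeisARS} (h : S.IsARS) {x y : ℝ}
    (hxy : x • S.B1 + y • S.B2 = 0) : x = 0 ∧ y = 0 := by
  obtain ⟨p, hp⟩ := h.1
  have hli : LinearIndependent ℝ ![S.lin p, S.V1 p, S.V2 p] := by
    refine linearIndependent_of_top_le_span_of_card_eq_finrank ?_ (by simp)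
    rw [Matrix.range_cons, Matrix.range_cons, Matrix.range_cons, Matrix.range_empty, union_empty,
      singleton_union, singleton_union, hp]
  rw [Fintype.linearIndependent_iff] at hli
  have h1 := congrArg Prod.fst hxy
  have h2 := congrArg (fun v : Heis => v.2.1) hxy
  have h3 := congrArg (fun v : Heis => v.2.2) hxy
  simp only [Prod.fst_add, Prod.snd_add, Prod.smul_fst, Prod.smul_snd, smul_eq_mul,
    Prod.fst_zero, Prod.snd_zero] at h1 h2 h3
  have := hli ![0, x, y] (by
    rw [Fin.sum_univ_three]
    ext <;> simp [V1_eq, V2_eq]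
    · exact h1
    · exact h2
    · linear_combination h3 + p.1 * h2)
  exact ⟨this 1, this 2⟩

theorem IsARS.exists_adapted_frame {S : HeisARS} (h : S.IsARS)
    (hS : heisBracket S.B1 S.B2 ∈ S.Delta) : ∃ x y α β γ l : ℝ, x ^ 2 + y ^ 2 = 1 ∧
      x • S.B1 + y • S.B2 = (α, β, γ) ∧ (-y) • S.B1 + x • S.B2 = (0, 0, l) ∧ l ≠ 0 ∧
      (α ≠ 0 ∨ β ≠ 0) := by
  have hδ : S.B1.1 * S.B2.2.1 - S.B2.1 * S.B1.2.1 = 0 := by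
    obtain ⟨s, t, hst⟩ := Submodule.mem_span_pair.1 hS
    have h1 := congrArg Prod.fst hst
    have h2 := congrArg (fun v : Heis => v.2.1) hst
    simp only [heisBracket, Prod.fst_add, Prod.snd_add, Prod.smul_fst, Prod.smul_snd,
      smul_eq_mul] at h1 h2
    by_contra hne
    have hs : s = 0 := by
      apply mul_right_cancel₀ hne
      linear_combination S.B2.2.1 * h1 - S.B2.1 * h2
    have ht : t = 0 := by
      apply mul_right_cancel₀ hne
      linear_combination S.B1.1 * h2 - S.B1.2.1 * h1
    subst hs ht
    have := congrArg (fun v : Heis => v.2.2) hst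
    simp only [heisBracket, zero_smul, add_zero, Prod.snd_zero] at this
    exact hne this.symm
  have hrot : ∃ x y : ℝ, x ^ 2 + y ^ 2 = 1 ∧ -y * S.B1.1 + x * S.B2.1 = 0 ∧
      -y * S.B1.2.1 + x * S.B2.2.1 = 0 := by
    have hnorm : ∀ u v : ℝ, (u ≠ 0 ∨ v ≠ 0) → ∃ k : ℝ, (k * u) ^ 2 + (k * v) ^ 2 = 1 := by
      intro u v huv
      have hpos : 0 < u ^ 2 + v ^ 2 := by
        rcases huv with hu | hv <;> positivity
      refine ⟨(Real.sqrt (u ^ 2 + v ^ 2))⁻¹, ?_⟩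
      rw [mul_pow, mul_pow, ← mul_add, inv_pow, Real.sq_sqrt hpos.le, inv_mul_cancel₀ hpos.ne']
    by_cases h1 : S.B1.1 ≠ 0 ∨ S.B2.1 ≠ 0
    · obtain ⟨k, hk⟩ := hnorm _ _ h1
      exact ⟨_, _, hk, by ring, by linear_combination k * hδ⟩
    by_cases h2 : S.B1.2.1 ≠ 0 ∨ S.B2.2.1 ≠ 0
    · obtain ⟨k, hk⟩ := hnorm _ _ h2
      exact ⟨_, _, hk, by linear_combination -k * hδ, by ring⟩
    push Not at h1 h2
    exact ⟨1, 0, by norm_num, by simp [h1], by simp [h2]⟩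
  obtain ⟨x, y, hxy, e1, e2⟩ := hrot
  refine ⟨x, y, x * S.B1.1 + y * S.B2.1, x * S.B1.2.1 + y * S.B2.2.1,
    x * S.B1.2.2 + y * S.B2.2.2, -y * S.B1.2.2 + x * S.B2.2.2, hxy, rfl, ?_, ?_, ?_⟩
  · exact Prod.ext e1 (Prod.ext e2 rfl)
  · intro h0
    obtain ⟨hy, hx⟩ := h.independent (x := -y) (y := x) (Prod.ext e1 (Prod.ext e2 h0))
    rw [neg_eq_zero] at hy
    subst hx hy
    norm_num at hxy
  · by_contra hcon
    push Not at hcon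
    obtain ⟨c1, c2⟩ := hcon
    have z1 : S.B1.1 = 0 := by linear_combination x * c1 - y * e1 - S.B1.1 * hxy
    have z2 : S.B2.1 = 0 := by linear_combination y * c1 + x * e1 - S.B2.1 * hxy
    have z3 : S.B1.2.1 = 0 := by linear_combination x * c2 - y * e2 - S.B1.2.1 * hxy
    have z4 : S.B2.2.1 = 0 := by linear_combination y * c2 + x * e2 - S.B2.2.1 * hxy
    obtain ⟨-, h0⟩ := h.independent (x := S.B2.2.2) (y := -S.B1.2.2) (by
      ext <;> simp [z1, z2, z3, z4]
      ring)
    rw [neg_eq_zero] at h0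
    have := h.independent (x := 1) (y := 0) (by ext <;> simp [z1, z3, h0])
    exact one_ne_zero this.1

theorem IsARS.transverse_ne_zero {S : HeisARS} (h : S.IsARS) {α β : ℝ} (hαβ : α ≠ 0 ∨ β ≠ 0)
    (h1 : α * S.B1.2.1 - β * S.B1.1 = 0) (h2 : α * S.B2.2.1 - β * S.B2.1 = 0) :
    α * (S.c * α + S.d * β) - β * (S.a * α + S.b * β) ≠ 0 := by
  intro hκ
  let L : Heis →L[ℝ] ℝ :=
    α • (ContinuousLinearMap.fst ℝ ℝ ℝ ∘L ContinuousLinearMap.snd ℝ ℝ (ℝ × ℝ)) -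
      β • ContinuousLinearMap.fst ℝ ℝ (ℝ × ℝ)
  have hL : ∀ v, L v = α * v.2.1 - β * v.1 := fun v => rfl
  have hF : ∀ V ∈ ({S.lin, S.V1, S.V2} : Set (Heis → Heis)), ∀ p, L p = 0 → L (V p) = 0 := by
    rintro V (rfl | rfl | rfl) p hp
    · rw [hL] at hp ⊢
      simp only [lin]
      rcases hαβ with hα | hβ
      · apply mul_left_cancel₀ hα
        linear_combination p.1 * hκ + (α * S.d - β * S.b) * hp
      · apply mul_left_cancel₀ hβ
        linear_combination p.2.1 * hκ + (β * S.a - α * S.c) * hp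
    · rw [hL, V1_eq]
      exact h1
    · rw [hL, V2_eq]
      exact h2
  have hle : Submodule.span ℝ {v : Heis | ∃ V : Heis → Heis,
      HeisLieGen {S.lin, S.V1, S.V2} V ∧ V 0 = v} ≤ LinearMap.ker (L : Heis →ₗ[ℝ] ℝ) := by
    rw [Submodule.span_le]
    rintro _ ⟨V, hV, rfl⟩
    exact hV.tangent hF 0 (map_zero L)
  rw [h.2 0] at hle
  have hz : ∀ v, L v = 0 := fun v => hle (Submodule.mem_top (x := v))
  rcases hαβ with hα | hβ
  · exact hα (by simpa [hL] using hz (0, 1, 0))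
  · exact hβ (by simpa [hL] using hz (1, 0, 0))

end HeisARS

theorem submodule_eq_top_of_mem {M : Submodule ℝ Heis} {u c w : ℝ} (hc : c ≠ 0)
    (h1 : ((1, 0, 0) : Heis) ∈ M) (h2 : ((u, c, w) : Heis) ∈ M)
    (h3 : ((0, 0, 1) : Heis) ∈ M) : M = ⊤ := by
  rw [eq_top_iff]
  rintro ⟨x, y, z⟩ -
  have : ((x, y, z) : Heis) =
      (x - y / c * u) • (1, 0, 0) + (y / c) • (u, c, w) + (z - y / c * w) • (0, 0, 1) := by
    ext <;> simp [hc]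
  rw [this]
  exact M.add_mem (M.add_mem (M.smul_mem _ h1) (M.smul_mem _ h2)) (M.smul_mem _ h3)

theorem isARS_subalgNormal (b d f : ℝ) {c : ℝ} (hc : c ≠ 0) : (subalgNormal b c d f).IsARS := by
  set N := subalgNormal b c d f with hN
  constructor
  · refine ⟨(1, 0, 0), submodule_eq_top_of_mem (u := 0) (c := c) (w := c / 2) hc ?_ ?_ ?_⟩ <;>
      apply Submodule.subset_span
    · exact Or.inr (Or.inl (subalgNormal_V1 b c d f _).symm)
    · left
      rw [hN, subalgNormal_lin]
      simp
    · exact Or.inr (Or.inr (subalgNormal_V2 b c d f _).symm)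
  · intro p
    have g0 : HeisLieGen {N.lin, N.V1, N.V2} N.lin := .base (by simp)
    have g1 : HeisLieGen {N.lin, N.V1, N.V2} N.V1 := .base (by simp)
    have g2 : HeisLieGen {N.lin, N.V1, N.V2} N.V2 := .base (by simp)
    refine submodule_eq_top_of_mem (u := 0) (c := c) (w := c * p.1) hc ?_ ?_ ?_ <;>
      apply Submodule.subset_span
    · exact ⟨_, g1, subalgNormal_V1 b c d f p⟩
    · refine ⟨_, g1.bracket g0, ?_⟩
      have hV : N.V1 = fun _ => (1, 0, 0) := funext (subalgNormal_V1 b c d f)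
      have hl : N.lin = fun p : Heis => (b * p.2.1, c * p.1 + d * p.2.1,
          f * p.2.1 + d * p.2.2 + c / 2 * p.1 ^ 2 + b / 2 * p.2.1 ^ 2) := by
        funext p
        rw [hN, subalgNormal_lin]
        ext <;> simp
        ring
      have h1 : HasFDerivAt (fun q : Heis => q.1) (ContinuousLinearMap.fst ℝ ℝ (ℝ × ℝ)) p :=
        hasFDerivAt_fst
      have h2 : HasFDerivAt (fun q : Heis => q.2.1)
          (ContinuousLinearMap.fst ℝ ℝ ℝ ∘L ContinuousLinearMap.snd ℝ ℝ (ℝ × ℝ)) p :=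
        hasFDerivAt_snd.fst
      have h3 : HasFDerivAt (fun q : Heis => q.2.2)
          (ContinuousLinearMap.snd ℝ ℝ ℝ ∘L ContinuousLinearMap.snd ℝ ℝ (ℝ × ℝ)) p :=
        hasFDerivAt_snd.snd
      have h := (h2.const_mul b).prodMk (((h1.const_mul c).add (h2.const_mul d)).prodMk
        ((((h2.const_mul f).add (h3.const_mul d)).add ((h1.pow 2).const_mul (c / 2))).add
          ((h2.pow 2).const_mul (b / 2))))
      replace h := h.congr_of_eventuallyEq (f₁ := N.lin) (.of_eq hl)
      rw [vfBracketH, h.fderiv, hV]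
      ext <;> simp
      ring
    · exact ⟨_, g2, subalgNormal_V2 b c d f p⟩

theorem exists_sq_eq_one_mul_nonneg (x : ℝ) : ∃ ε : ℝ, ε ^ 2 = 1 ∧ 0 ≤ ε * x := by
  rcases le_total 0 x with h | h
  · exact ⟨1, by norm_num, by linarith⟩
  · exact ⟨-1, by norm_num, by linarith⟩

theorem exists_isometric_subalgNormal {S : HeisARS} (h : S.IsARS)
    (hS : heisBracket S.B1 S.B2 ∈ S.Delta) : ∃ b c d f : ℝ, 0 < c ∧ 0 ≤ d ∧ 0 ≤ f ∧
      (subalgNormal b c d f).IsARS ∧ HeisIsometric S (subalgNormal b c d f) := by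
  obtain ⟨x, y, α, β, γ, l, hxy, e1, e2, hl, hαβ⟩ := h.exists_adapted_frame hS
  have a1 := congrArg Prod.fst e1
  have a2 := congrArg (fun v : Heis => v.2.1) e1
  have a3 := congrArg (fun v : Heis => v.2.2) e1
  have b1 := congrArg Prod.fst e2
  have b2 := congrArg (fun v : Heis => v.2.1) e2
  have b3 := congrArg (fun v : Heis => v.2.2) e2
  simp only [Prod.fst_add, Prod.snd_add, Prod.smul_fst, Prod.smul_snd, smul_eq_mul]
    at a1 a2 a3 b1 b2 b3
  set κ := α * (S.c * α + S.d * β) - β * (S.a * α + S.b * β) with hκ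
  have hκ0 : κ ≠ 0 := by
    have c1 : S.B1.1 = x * α := by linear_combination x * a1 - y * b1 - S.B1.1 * hxy
    have c2 : S.B2.1 = y * α := by linear_combination y * a1 + x * b1 - S.B2.1 * hxy
    have c3 : S.B1.2.1 = x * β := by linear_combination x * a2 - y * b2 - S.B1.2.1 * hxy
    have c4 : S.B2.2.1 = y * β := by linear_combination y * a2 + x * b2 - S.B2.2.1 * hxy
    exact h.transverse_ne_zero hαβ (by rw [c1, c3]; ring) (by rw [c2, c4]; ring)
  obtain ⟨ε, hε, hεd⟩ := exists_sq_eq_one_mul_nonneg (S.a + S.d)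
  have hε0 : ε ≠ 0 := by rintro rfl; norm_num at hε
  obtain ⟨τ, hτ, hτc⟩ := exists_sq_eq_one_mul_nonneg (ε * κ / l)
  have hτ0 : τ ≠ 0 := by rintro rfl; norm_num at hτ
  obtain ⟨σ, hσ, hσf⟩ := exists_sq_eq_one_mul_nonneg
    ((S.e * (S.a * α + S.b * β) + S.f * (S.c * α + S.d * β) + (S.a * S.d - S.b * S.c) * γ) /
      (ε * κ))
  set c := τ * (ε * κ / l) with hc
  have hc0 : c ≠ 0 := by rw [hc]; positivity
  have hcpos : 0 < c := lt_of_le_of_ne hτc hc0.symm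
  have hcl : c * (τ * l) = ε * κ := by
    rw [hc]
    field_simp
    linear_combination hτ
  set q := ε * σ * (S.a * α + S.b * β) / c with hq
  set s := ε * σ * (S.c * α + S.d * β) / c with hs
  set n := ε * σ * (S.e * α + S.f * β + (S.a + S.d) * γ) / c with hn
  have hq' : c * q = ε * σ * (S.a * α + S.b * β) := mul_div_cancel₀ _ hc0
  have hs' : c * s = ε * σ * (S.c * α + S.d * β) := mul_div_cancel₀ _ hc0
  have hn' : c * n = ε * σ * (S.e * α + S.f * β + (S.a + S.d) * γ) := mul_div_cancel₀ _ hc0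
  have hdet : σ * α * s - q * (σ * β) = τ * l := by
    apply mul_left_cancel₀ hc0
    linear_combination σ * α * hs' - σ * β * hq' - hcl + ε * κ * hσ - ε * σ ^ 2 * hκ
  set f := σ * ((S.e * (S.a * α + S.b * β) + S.f * (S.c * α + S.d * β) +
    (S.a * S.d - S.b * S.c) * γ) / (ε * κ)) with hf
  have hf' : f * (ε * κ) = σ * (S.e * (S.a * α + S.b * β) + S.f * (S.c * α + S.d * β) +
      (S.a * S.d - S.b * S.c) * γ) := by
    rw [hf, mul_assoc, div_mul_cancel₀]
    positivity
  set b := -(S.a * S.d - S.b * S.c) / c with hb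
  have hb' : c * b = -(S.a * S.d - S.b * S.c) := mul_div_cancel₀ _ hc0
  have hlin := fderiv_heisAut_lin (S := S) (b := b) (c := c) (d := ε * (S.a + S.d)) (f := f)
    (ε := ε) (p := σ * α) (q := q) (r := σ * β) (s := s) (m := σ * γ) (n := n)
    (by linear_combination -hq') (by linear_combination -hs') (by linear_combination -hn')
    (mul_left_cancel₀ hc0 <| by
      linear_combination ε * (S.a * hq' + S.b * hs') - σ * α * hb' - ε * (S.a + S.d) * hq' +
        σ * (S.a * (S.a * α + S.b * β) + S.b * (S.c * α + S.d * β) -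
          (S.a + S.d) * (S.a * α + S.b * β)) * hε)
    (mul_left_cancel₀ hc0 <| by
      linear_combination ε * (S.c * hq' + S.d * hs') - σ * β * hb' - ε * (S.a + S.d) * hs' +
        σ * (S.c * (S.a * α + S.b * β) + S.d * (S.c * α + S.d * β) -
          (S.a + S.d) * (S.c * α + S.d * β)) * hε)
    (mul_left_cancel₀ hc0 <| by
      rw [hdet]
      linear_combination ε * (S.e * hq' + S.f * hs') - σ * γ * hb' - f * hcl - hf' +
        σ * (S.e * (S.a * α + S.b * β) + S.f * (S.c * α + S.d * β)) * hε)
    rfl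
  refine ⟨b, c, ε * (S.a + S.d), f, hcpos, hεd, hσf, isARS_subalgNormal _ _ _ hc0,
    HeisIsometric.symm ⟨heisAut (σ * α) q (σ * β) s (σ * γ) n, ?_⟩⟩
  refine isHeisIsometry_of_frame (ε := ε) (τ := τ * σ) (x := σ * x) (y := σ * y)
    (isHeisDiffeo_heisAut _ _ (by rw [hdet]; positivity)) hε
    (by linear_combination σ ^ 2 * hτ + hσ) (by linear_combination σ ^ 2 * hxy + hσ) hlin ?_ ?_
  · intro p
    rw [subalgNormal_V1, fderiv_heisAut, S.V1_eq, S.V2_eq]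
    simp only [heisAut, Prod.smul_mk, Prod.mk_add_mk, smul_eq_mul, Prod.mk.injEq]
    refine ⟨?_, ?_, ?_⟩
    · linear_combination -σ * a1
    · linear_combination -σ * a2
    · linear_combination -σ * a3 - σ * (σ * α * p.1 + q * p.2.1) * a2
  · intro p
    rw [subalgNormal_V2, fderiv_heisAut, S.V1_eq, S.V2_eq, hdet]
    simp only [heisAut, Prod.smul_mk, Prod.mk_add_mk, smul_eq_mul, Prod.mk.injEq]
    refine ⟨?_, ?_, ?_⟩
    · linear_combination -τ * σ ^ 2 * b1
    · linear_combination -τ * σ ^ 2 * b2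
    · linear_combination -τ * σ ^ 2 * b3 - τ * σ ^ 2 * (σ * α * p.1 + q * p.2.1) * b2 - τ * l * hσ

/-- Every ARS on the Heisenberg group whose distribution is a Lie
subalgebra is isometric to a normalized one with frame `{X, Z, 𝒳}` and derivation
`D = [[0,b,0],[c,d,0],[0,f,d]]`, `c > 0`, `d, f ≥ 0`; and two different normalized
ARSs of this form are not isometric. -/
theorem heis_subalgebra_classification :
    (∀ S : HeisARS, S.IsARS → heisBracket S.B1 S.B2 ∈ S.Delta →
      ∃ b c d f : ℝ, 0 < c ∧ 0 ≤ d ∧ 0 ≤ f ∧ (subalgNormal b c d f).IsARS ∧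
        HeisIsometric S (subalgNormal b c d f)) ∧
    (∀ b c d f b' c' d' f' : ℝ, 0 < c → 0 ≤ d → 0 ≤ f → 0 < c' → 0 ≤ d' → 0 ≤ f' →
      HeisIsometric (subalgNormal b c d f) (subalgNormal b' c' d' f') →
      b = b' ∧ c = c' ∧ d = d' ∧ f = f') :=
  ⟨fun _ => exists_isometric_subalgNormal,
    fun _ _ _ _ _ _ _ _ => subalgNormal_params_eq⟩

end
end
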